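/- arXiv:1206.3659 — 2 statements merged into one kernel-verified Lean document; each statement's English description precedes it below -/
import Mathlib

section
/- Let s > 0 and 1 ≤ p, r ≤ ∞. Then there exists a constant C such that for all f, g in B^s_{p,r}(S) ∩ L^∞(S), ‖fg‖_{B^s_{p,r}} ≤ C(‖f‖_{B^s_{p,r}}‖g‖_{L^∞} + ‖g‖_{B^s_{p,r}}‖f‖_{L^∞}). -/
open MeasureTheory Filter
open scoped ENNReal NNReal

noncomputable section

/-- The `β`-th Fourier coefficient of a 1-periodic function `u : ℝ → ℂ`. -/
def fourierCoeff' (u : ℝ → ℂ) (β : ℤ) : ℂ :=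
  ∫ x in (0:ℝ)..1, u x * Complex.exp (-(2 * (Real.pi : ℂ) * Complex.I * (β : ℂ) * (x : ℂ)))

/-- An admissible pair of dyadic cutoff functions for a Littlewood–Paley
decomposition: `χ ∈ C_c^∞({|ξ| ≤ 4/3})`, `φ ∈ C_c^∞({3/4 ≤ |ξ| ≤ 8/3})` with
`χ(ξ) + ∑_{q ≥ 0} φ(2^{-q}ξ) = 1` for all `ξ ∈ ℝ`. -/
structure LPPair where
  χ : ℝ → ℝ
  φ : ℝ → ℝ
  χ_smooth : ContDiff ℝ (⊤ : ℕ∞) χ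
  φ_smooth : ContDiff ℝ (⊤ : ℕ∞) φ
  χ_supp : ∀ ξ : ℝ, (4:ℝ)/3 < |ξ| → χ ξ = 0
  φ_supp : ∀ ξ : ℝ, (|ξ| < 3/4 ∨ (8:ℝ)/3 < |ξ|) → φ ξ = 0
  sum_one : ∀ ξ : ℝ, χ ξ + ∑' q : ℕ, φ ((2:ℝ) ^ (-(q:ℤ)) * ξ) = 1

/-- The dyadic cutoff applied at frequency `β`, block index `q`:
`χ(β)` for `q = -1`, `φ(2^{-q}β)` for `q ≥ 0`, and `0` for `q ≤ -2`. -/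
def LPcutoff (P : LPPair) (q : ℤ) (β : ℤ) : ℝ :=
  if q = -1 then P.χ (β : ℝ)
  else if 0 ≤ q then P.φ ((2:ℝ) ^ (-q) * (β : ℝ))
  else 0

/-- The Littlewood–Paley block `Δ_q` acting on a Fourier coefficient sequence `c`,
realised as the trigonometric polynomial `x ↦ ∑_β cutoff(q,β) c_β e^{2πiβx}`. -/
def LPblockC (P : LPPair) (q : ℤ) (c : ℤ → ℂ) : ℝ → ℂ :=
  fun x => ∑' β : ℤ, (LPcutoff P q β : ℂ) * c β *
    Complex.exp (2 * (Real.pi : ℂ) * Complex.I * (β : ℂ) * (x : ℂ))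

/-- The Littlewood–Paley block `Δ_q u` of a 1-periodic function `u`. -/
def LPblock (P : LPPair) (q : ℤ) (u : ℝ → ℂ) : ℝ → ℂ :=
  LPblockC P q (fourierCoeff' u)

/-- The partial sum `S_q u = ∑_{-1 ≤ j ≤ q-1} Δ_j u`. -/
def LPpartial (P : LPPair) (q : ℤ) (u : ℝ → ℂ) : ℝ → ℂ :=
  fun x => ∑ j ∈ Finset.Icc (-1 : ℤ) (q - 1), LPblock P j u x

/-- The `L^p` norm over one period of the circle `S = ℝ/ℤ`. -/
def circLp (p : ℝ≥0∞) (g : ℝ → ℂ) : ℝ≥0∞ :=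
  eLpNorm g p (volume.restrict (Set.Ioc (0:ℝ) 1))

/-- The Besov norm `‖·‖_{B^s_{p,r}(S)}` of a Fourier coefficient sequence:
`ℓ^r` (over `q ∈ ℤ`) of `2^{qs}‖Δ_q u‖_{L^p}`. -/
def besovNormC (P : LPPair) (s : ℝ) (p r : ℝ≥0∞) (c : ℤ → ℂ) : ℝ≥0∞ :=
  if r = ⊤ then ⨆ q : ℤ, ENNReal.ofReal ((2:ℝ) ^ ((q : ℝ) * s)) * circLp p (LPblockC P q c)
  else (∑' q : ℤ, (ENNReal.ofReal ((2:ℝ) ^ ((q : ℝ) * s)) * circLp p (LPblockC P q c)) ^ r.toReal)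
        ^ (1 / r.toReal)

/-- The Besov norm of a 1-periodic function. -/
def besovNorm (P : LPPair) (s : ℝ) (p r : ℝ≥0∞) (u : ℝ → ℂ) : ℝ≥0∞ :=
  besovNormC P s p r (fourierCoeff' u)

/-- Membership in the periodic Besov space `B^s_{p,r}(S)`. -/
def MemBesov (P : LPPair) (s : ℝ) (p r : ℝ≥0∞) (u : ℝ → ℂ) : Prop :=
  Function.Periodic u 1 ∧ (∀ a b : ℝ, IntervalIntegrable u volume a b) ∧
    besovNorm P s p r u < ⊤


/-- Jensen's inequality for a kernel of total mass at most `A`. -/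
lemma lintegral_mul_rpow_le_of_mass_le {Y : Type*} [MeasurableSpace Y] {ν : Measure Y}
    {k v : Y → ℝ≥0∞} (hk : Measurable k) (hv : AEMeasurable v ν) {A : ℝ≥0∞}
    (hA : ∫⁻ y, k y ∂ν ≤ A) {p : ℝ} (hp : 1 ≤ p) :
    (∫⁻ y, k y * v y ∂ν) ^ p ≤ A ^ (p - 1) * ∫⁻ y, k y * v y ^ p ∂ν := by
  rcases hp.eq_or_lt with rfl | hp
  · simp
  have hp0 : 0 < p := by linarith
  have hq := (Real.HolderConjugate.conjExponent hp).symm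
  set q := p.conjExponent with hqdef
  have hq0 : 0 < q := hq.pos
  have hsum : 1 / q + 1 / p = 1 := by simpa using hq.inv_add_inv_eq_one
  have h := ENNReal.lintegral_mul_le_Lp_mul_Lq ν hq (f := fun y => k y ^ (1 / q))
    (g := fun y => k y ^ (1 / p) * v y) (hk.pow_const _).aemeasurable
    ((hk.pow_const _).aemeasurable.mul hv)
  have e1 : ∀ y, k y ^ (1 / q) * (k y ^ (1 / p) * v y) = k y * v y := fun y => by
    rw [← mul_assoc, ← ENNReal.rpow_add_of_nonneg _ _ (by positivity) (by positivity), hsum,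
      ENNReal.rpow_one]
  have e2 : ∀ y, (k y ^ (1 / q)) ^ q = k y := fun y => by
    rw [← ENNReal.rpow_mul, one_div_mul_cancel hq0.ne', ENNReal.rpow_one]
  have e3 : ∀ y, (k y ^ (1 / p) * v y) ^ p = k y * v y ^ p := fun y => by
    rw [ENNReal.mul_rpow_of_nonneg _ _ hp0.le, ← ENNReal.rpow_mul, one_div_mul_cancel hp0.ne',
      ENNReal.rpow_one]
  simp only [Pi.mul_apply, e1, e2, e3] at h
  calc (∫⁻ y, k y * v y ∂ν) ^ p
      ≤ ((∫⁻ y, k y ∂ν) ^ (1 / q) * (∫⁻ y, k y * v y ^ p ∂ν) ^ (1 / p)) ^ p := by gcongr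
    _ = (∫⁻ y, k y ∂ν) ^ (p - 1) * ∫⁻ y, k y * v y ^ p ∂ν := by
        rw [ENNReal.mul_rpow_of_nonneg _ _ hp0.le, ← ENNReal.rpow_mul, ← ENNReal.rpow_mul,
          one_div_mul_cancel hp0.ne', ENNReal.rpow_one]
        congr 2
        have : 1 / q = 1 - 1 / p := by linarith
        rw [this]; field_simp
    _ ≤ A ^ (p - 1) * ∫⁻ y, k y * v y ^ p ∂ν := by
        gcongr

/-- Schur's test for nonnegative kernels. -/
lemma eLpNorm_lintegral_kernel_le {X Y : Type*} [MeasurableSpace X] [MeasurableSpace Y]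
    {μ : Measure X} {ν : Measure Y} [SFinite μ] [SFinite ν]
    {k : X → Y → ℝ≥0∞} {v : Y → ℝ≥0∞} (hk : Measurable (Function.uncurry k))
    (hv : AEMeasurable v ν) {A : ℝ≥0∞} (h₁ : ∀ x, ∫⁻ y, k x y ∂ν ≤ A)
    (h₂ : ∀ y, ∫⁻ x, k x y ∂μ ≤ A) {p : ℝ≥0∞} (hp : 1 ≤ p) :
    eLpNorm (fun x => ∫⁻ y, k x y * v y ∂ν) p μ ≤ A * eLpNorm v p ν := by
  have hkx : ∀ x, Measurable (k x) := fun x => hk.comp measurable_prodMk_left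
  have hky : ∀ y, Measurable fun x => k x y := fun y => hk.comp measurable_prodMk_right
  by_cases hpt : p = ⊤
  · subst hpt
    simp only [eLpNorm_exponent_top]
    refine essSup_le_of_ae_le _ (Eventually.of_forall fun x => ?_)
    simp only [enorm_eq_self]
    calc ∫⁻ y, k x y * v y ∂ν ≤ ∫⁻ y, k x y * eLpNormEssSup v ν ∂ν := by
          refine lintegral_mono_ae ?_
          filter_upwards [enorm_ae_le_eLpNormEssSup v ν] with y hy
          rw [enorm_eq_self] at hy
          gcongr
      _ = (∫⁻ y, k x y ∂ν) * eLpNormEssSup v ν := lintegral_mul_const _ (hkx x)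
      _ ≤ _ := by gcongr; exact h₁ x
  have hp0 : p ≠ 0 := (zero_lt_one.trans_le hp).ne'
  have hp1 : 1 ≤ p.toReal := by
    simpa using ENNReal.toReal_mono hpt hp
  have hpp : 0 < p.toReal := by linarith
  rw [eLpNorm_eq_lintegral_rpow_enorm_toReal hp0 hpt, eLpNorm_eq_lintegral_rpow_enorm_toReal hp0 hpt]
  simp only [enorm_eq_self]
  set t := p.toReal
  have hm : AEMeasurable (Function.uncurry fun x y => k x y * v y ^ t) (μ.prod ν) :=
    hk.aemeasurable.mul (hv.pow_const t).comp_snd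
  have key : ∫⁻ x, (∫⁻ y, k x y * v y ∂ν) ^ t ∂μ ≤ A ^ t * ∫⁻ y, v y ^ t ∂ν :=
    calc ∫⁻ x, (∫⁻ y, k x y * v y ∂ν) ^ t ∂μ
        ≤ ∫⁻ x, A ^ (t - 1) * ∫⁻ y, k x y * v y ^ t ∂ν ∂μ :=
          lintegral_mono fun x => lintegral_mul_rpow_le_of_mass_le (hkx x) hv (h₁ x) hp1
      _ = A ^ (t - 1) * ∫⁻ x, ∫⁻ y, k x y * v y ^ t ∂ν ∂μ :=
          lintegral_const_mul'' _ hm.lintegral_prod_right'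
      _ = A ^ (t - 1) * ∫⁻ y, (∫⁻ x, k x y ∂μ) * v y ^ t ∂ν := by
          rw [lintegral_lintegral_swap hm]
          congr 1
          exact lintegral_congr fun y => lintegral_mul_const _ (hky y)
      _ ≤ A ^ (t - 1) * ∫⁻ y, A * v y ^ t ∂ν := by
          gcongr with y; exact h₂ y
      _ = A ^ t * ∫⁻ y, v y ^ t ∂ν := by
          rw [lintegral_const_mul'' _ (hv.pow_const t), ← mul_assoc]
          congr 1
          conv_lhs => rw [← ENNReal.rpow_one A, ← ENNReal.rpow_mul, one_mul]
          rw [← ENNReal.rpow_add_of_nonneg _ _ (by linarith) zero_le_one]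
          congr 1; ring
  calc _ ≤ (A ^ t * ∫⁻ y, v y ^ t ∂ν) ^ (1 / t) := by gcongr
    _ = _ := by
      rw [ENNReal.mul_rpow_of_nonneg _ _ (by positivity), ← ENNReal.rpow_mul,
        mul_one_div_cancel hpp.ne', ENNReal.rpow_one]

lemma exists_abs_second_difference_le {ψ : ℝ → ℝ} (hψ : ContDiff ℝ (⊤ : ℕ∞) ψ)
    (hc : HasCompactSupport ψ) :
    ∃ M : ℝ, 0 ≤ M ∧ ∀ t h : ℝ, |2 * ψ t - ψ (t - h) - ψ (t + h)| ≤ M * h ^ 2 := by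
  have hd : ContDiff ℝ 1 (deriv ψ) := by
    have : ContDiff ℝ (1 + 1) ψ := hψ.of_le (by norm_cast)
    exact ((contDiff_succ_iff_deriv (n := 1)).1 this).2.2
  obtain ⟨L, hL⟩ := hd.lipschitzWith_of_hasCompactSupport hc.deriv one_ne_zero
  refine ⟨2 * L, by positivity, fun t h => ?_⟩
  have hdiff : Differentiable ℝ ψ := hψ.differentiable (by simp)
  have hder : ∀ x, HasDerivAt (fun y => 2 * ψ t - ψ (t - y) - ψ (t + y))
      (deriv ψ (t - x) - deriv ψ (t + x)) x := fun x => by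
    have h1 := (hdiff (t - x)).hasDerivAt.comp x ((hasDerivAt_id x).const_sub t)
    have h2 := (hdiff (t + x)).hasDerivAt.comp x ((hasDerivAt_id x).const_add t)
    convert! ((hasDerivAt_const x (2 * ψ t)).sub h1).sub h2 using 1
    simp
  have hbd : ∀ x ∈ Metric.closedBall (0 : ℝ) |h|,
      ‖deriv ψ (t - x) - deriv ψ (t + x)‖ ≤ 2 * L * |h| := fun x hx => by
    have := hL.dist_le_mul (t - x) (t + x)
    rw [dist_eq_norm, dist_eq_norm] at this
    refine this.trans ?_
    have e : t - x - (t + x) = -(2 * x) := by ring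
    have hx' : |x| ≤ |h| := by simpa using hx
    rw [e, norm_neg, Real.norm_eq_abs, abs_mul, abs_two]
    nlinarith [L.2]
  have := (convex_closedBall (0 : ℝ) |h|).norm_image_sub_le_of_norm_hasDerivWithin_le
    (fun x _ => (hder x).hasDerivWithinAt) hbd (x := 0) (y := h) (by simp) (by simp)
  simp only [sub_zero, add_zero, Real.norm_eq_abs] at this
  have e : 2 * ψ t - ψ t - ψ t = 0 := by ring
  rw [e, sub_zero] at this
  rw [← sq_abs h]
  linarith

/-- The convolution kernel of the Fourier multiplier with symbol `m`. -/
def multKernel (m : ℤ → ℝ) (z : ℝ) : ℂ :=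
  ∑' β : ℤ, (m β : ℂ) * Complex.exp (2 * (Real.pi : ℂ) * Complex.I * (β : ℂ) * (z : ℂ))

lemma norm_exp_two_pi_I_mul (β : ℤ) (z : ℝ) :
    ‖Complex.exp (2 * (Real.pi : ℂ) * Complex.I * (β : ℂ) * (z : ℂ))‖ = 1 := by
  have : 2 * (Real.pi : ℂ) * Complex.I * (β : ℂ) * (z : ℂ)
      = ((2 * Real.pi * β * z : ℝ) : ℂ) * Complex.I := by push_cast; ring
  rw [this, Complex.norm_exp_ofReal_mul_I]

lemma norm_multKernel_le {m : ℤ → ℝ} {B : ℝ} {n : ℕ} (hB : ∀ β, |m β| ≤ B)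
    (hm : ∀ β : ℤ, (n : ℤ) < |β| → m β = 0) (z : ℝ) :
    ‖multKernel m z‖ ≤ (2 * n + 1) * B := by
  have : multKernel m z = ∑ β ∈ Finset.Icc (-n : ℤ) n,
      (m β : ℂ) * Complex.exp (2 * (Real.pi : ℂ) * Complex.I * (β : ℂ) * (z : ℂ)) := by
    refine tsum_eq_sum fun β hβ => ?_
    rw [hm β, Complex.ofReal_zero, zero_mul]
    rw [Finset.mem_Icc, ← abs_le] at hβ
    exact not_le.1 hβ
  rw [this]
  refine (norm_sum_le_of_le _ (f := _) (n := fun _ => B) fun β _ => ?_).trans ?_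
  · rw [norm_mul, norm_exp_two_pi_I_mul, mul_one, Complex.norm_real]
    exact hB β
  · rw [Finset.sum_const, Int.card_Icc, nsmul_eq_mul]
    have : (((n : ℤ) + 1 - -n).toNat : ℝ) = 2 * n + 1 := by
      have h : ((n : ℤ) + 1 - -n).toNat = 2 * n + 1 := by omega
      rw [h]; push_cast; ring
    rw [this]

lemma summable_multKernel {m : ℤ → ℝ} (hm : m.support.Finite) (z : ℝ) :
    Summable fun β : ℤ =>
      (m β : ℂ) * Complex.exp (2 * (Real.pi : ℂ) * Complex.I * (β : ℂ) * (z : ℂ)) := by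
  refine summable_of_hasFiniteSupport (hm.subset fun β hβ h => hβ ?_)
  simp [h]

lemma two_sub_two_mul_cos_mul_multKernel {m : ℤ → ℝ} (hm : m.support.Finite) (z : ℝ) :
    ((2 - 2 * Real.cos (2 * Real.pi * z) : ℝ) : ℂ) * multKernel m z =
      multKernel (fun β => 2 * m β - m (β - 1) - m (β + 1)) z := by
  set e : ℤ → ℂ := fun β => Complex.exp (2 * (Real.pi : ℂ) * Complex.I * (β : ℂ) * (z : ℂ)) with he
  have hadd : ∀ a b, e (a + b) = e a * e b := fun a b => by
    simp only [he, ← Complex.exp_add]; congr 1; push_cast; ring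
  have hcos : ((2 - 2 * Real.cos (2 * Real.pi * z) : ℝ) : ℂ) = 2 - e 1 - e (-1) := by
    have h1 : e 1 = Complex.exp (2 * Real.pi * z * Complex.I) := by
      simp only [he]; congr 1; push_cast; ring
    have h2 : e (-1) = Complex.exp (-(2 * Real.pi * z) * Complex.I) := by
      simp only [he]; congr 1; push_cast; ring
    push_cast
    rw [Complex.two_cos, h1, h2, sub_sub]
  have h0 : HasSum (fun β => (m β : ℂ) * e β) (multKernel m z) := (summable_multKernel hm z).hasSum
  have h1 : HasSum (fun β : ℤ => (m (β - 1) : ℂ) * e β) (multKernel m z * e 1) := by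
    have := (Equiv.subRight (1 : ℤ)).hasSum_iff.2 (h0.mul_right (e 1))
    refine this.congr_fun fun β => ?_
    simp only [Function.comp, Equiv.subRight_apply, mul_assoc, ← hadd, sub_add_cancel]
  have h2 : HasSum (fun β : ℤ => (m (β + 1) : ℂ) * e β) (multKernel m z * e (-1)) := by
    have := (Equiv.addRight (1 : ℤ)).hasSum_iff.2 (h0.mul_right (e (-1)))
    refine this.congr_fun fun β => ?_
    simp only [Function.comp, Equiv.coe_addRight, mul_assoc, ← hadd, add_neg_cancel_right]
  have h3 := ((h0.mul_left 2).sub h1).sub h2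
  rw [hcos]
  have e3 : (2 - e 1 - e (-1)) * multKernel m z
      = 2 * multKernel m z - multKernel m z * e 1 - multKernel m z * e (-1) := by ring
  rw [e3, ← h3.tsum_eq]
  refine tsum_congr fun β => ?_
  push_cast
  ring

lemma continuous_multKernel {m : ℤ → ℝ} (hm : m.support.Finite) : Continuous (multKernel m) := by
  have : multKernel m = fun z : ℝ => ∑ β ∈ hm.toFinset,
      (m β : ℂ) * Complex.exp (2 * (Real.pi : ℂ) * Complex.I * (β : ℂ) * (z : ℂ)) := by
    funext z
    refine tsum_eq_sum fun β hβ => ?_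
    have : m β = 0 := by simpa using hβ
    simp [this]
  rw [this]
  fun_prop

lemma periodic_multKernel (m : ℤ → ℝ) : Function.Periodic (multKernel m) 1 := fun z => by
  refine tsum_congr fun β => ?_
  congr 1
  rw [Complex.exp_eq_exp_iff_exists_int]
  exact ⟨β, by push_cast; ring⟩

/-- Kernels of dilated smooth compactly supported symbols are uniformly bounded in `L¹`. -/
lemma exists_lintegral_multKernel_dilation_le {ψ : ℝ → ℝ} (hψ : ContDiff ℝ (⊤ : ℕ∞) ψ)
    (hsupp : ∀ ξ : ℝ, (4 : ℝ) / 3 < |ξ| → ψ ξ = 0) :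
    ∃ A : ℝ, ∀ N : ℕ, 0 < N → ∀ a : ℝ,
      ∫⁻ z in Set.Ioc a (a + 1), ‖multKernel (fun β => ψ (β / N)) z‖ₑ ≤ ENNReal.ofReal A := by
  have hc : HasCompactSupport ψ := by
    refine HasCompactSupport.intro (isCompact_closedBall (0 : ℝ) (4 / 3)) fun ξ hξ => hsupp ξ ?_
    simpa using hξ
  obtain ⟨B, hB⟩ := hc.exists_bound_of_continuous hψ.continuous
  obtain ⟨M, hM0, hM⟩ := exists_abs_second_difference_le hψ hc
  have hB0 : 0 ≤ B := (norm_nonneg _).trans (hB 0)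
  set D := 5 * B + 7 * M with hD
  refine ⟨D * Real.pi, fun N hN a => ?_⟩
  have hNr : (1 : ℝ) ≤ N := by exact_mod_cast hN
  set m : ℤ → ℝ := fun β => ψ (β / N) with hmdef
  have hm0 : ∀ β : ℤ, ((2 * N : ℕ) : ℤ) < |β| → m β = 0 := fun β hβ => by
    refine hsupp _ ?_
    have : (2 * N : ℝ) < |(β : ℝ)| := by exact_mod_cast hβ
    rw [abs_div, Nat.abs_cast, lt_div_iff₀ (by positivity)]
    linarith
  have hfin : m.support.Finite := by
    refine (Set.finite_Icc (-(2 * N : ℕ) : ℤ) (2 * N : ℕ)).subset fun β hβ => ?_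
    rw [Set.mem_Icc, ← abs_le]
    by_contra h
    exact hβ (hm0 β (not_le.1 h))
  have hb1 : ∀ z, ‖multKernel m z‖ ≤ 5 * N * B := fun z => by
    refine (norm_multKernel_le (fun β => hB (β / N)) hm0 z).trans ?_
    push_cast
    nlinarith
  have hb2 : ∀ z, (2 - 2 * Real.cos (2 * Real.pi * z)) * ‖multKernel m z‖ ≤ 7 * M / N := fun z => by
    have hnn : 0 ≤ 2 - 2 * Real.cos (2 * Real.pi * z) := by
      linarith [Real.cos_le_one (2 * Real.pi * z)]
    have h := congrArg norm (two_sub_two_mul_cos_mul_multKernel hfin z)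
    rw [norm_mul, Complex.norm_real, Real.norm_of_nonneg hnn] at h
    rw [h]
    have hdd : ∀ β : ℤ, |2 * m β - m (β - 1) - m (β + 1)| ≤ M * (1 / N) ^ 2 := fun β => by
      have := hM (β / N) (1 / N)
      simp only [hmdef]
      push_cast
      rwa [sub_div, add_div]
    refine (norm_multKernel_le (n := 3 * N) hdd (fun β hβ => ?_) z).trans ?_
    · have h1 : (2 * N : ℤ) < |β| := by push_cast at hβ; omega
      have h2 : (2 * N : ℤ) < |β - 1| := by
        have := abs_sub_abs_le_abs_sub β 1
        push_cast at hβ; rw [abs_one] at this; omega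
      have h3 : (2 * N : ℤ) < |β + 1| := by
        have := abs_sub_abs_le_abs_sub β (-1)
        push_cast at hβ; rw [abs_neg, abs_one, sub_neg_eq_add] at this; omega
      rw [hm0 _ (by exact_mod_cast h1), hm0 _ (by exact_mod_cast h2), hm0 _ (by exact_mod_cast h3)]
      ring
    · push_cast
      rw [div_pow, one_pow, mul_one_div, mul_div_assoc', div_le_div_iff₀ (by positivity)
        (by positivity)]
      have : M * N ≤ M * N ^ 2 := by gcongr; nlinarith
      nlinarith [mul_nonneg hM0 (by linarith : (0 : ℝ) ≤ N)]
  have hpt : ∀ z : ℝ, |z| ≤ 1 / 2 → ‖multKernel m z‖ ≤ D * (N * (1 + (N * z) ^ 2)⁻¹) := fun z hz => by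
    have hcos := Real.cos_le_one_sub_mul_cos_sq (x := 2 * Real.pi * z) (by
      rw [abs_mul, abs_of_pos (by positivity)]; nlinarith [Real.pi_pos])
    have e : 2 / Real.pi ^ 2 * (2 * Real.pi * z) ^ 2 = 8 * z ^ 2 := by
      field_simp; ring
    rw [e] at hcos
    have h2 : 16 * z ^ 2 * ‖multKernel m z‖ ≤ 7 * M / N :=
      (mul_le_mul_of_nonneg_right (by linarith) (norm_nonneg _)).trans (hb2 z)
    rw [← mul_assoc, ← div_eq_mul_inv, le_div_iff₀ (by positivity)]
    have h3 : (N * z) ^ 2 * ‖multKernel m z‖ ≤ 7 * M * N := by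
      have : N ^ 2 * (16 * z ^ 2 * ‖multKernel m z‖) ≤ N ^ 2 * (7 * M / N) := by gcongr
      have e2 : (N : ℝ) ^ 2 * (7 * M / N) = 7 * M * N := by field_simp
      rw [e2] at this
      nlinarith [mul_nonneg (sq_nonneg (N * z)) (norm_nonneg (multKernel m z))]
    nlinarith [hb1 z]
  have hcont : Continuous fun z => ‖multKernel m z‖ := (continuous_multKernel hfin).norm
  have hper : Function.Periodic (fun z => ‖multKernel m z‖) 1 := fun z => by
    simp only [periodic_multKernel m z]
  have hint : Integrable fun z : ℝ => D * (N * (1 + (N * z) ^ 2)⁻¹) :=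
    ((integrable_inv_one_add_sq.comp_mul_left' (by positivity)).const_mul _).const_mul _
  have hle : ∫ z in a..(a + 1), ‖multKernel m z‖ ≤ D * Real.pi := by
    rw [hper.intervalIntegral_add_eq a (-(1 / 2)), intervalIntegral.integral_of_le (by linarith)]
    calc ∫ z in Set.Ioc (-(1 / 2) : ℝ) (-(1 / 2) + 1), ‖multKernel m z‖
        ≤ ∫ z in Set.Ioc (-(1 / 2) : ℝ) (-(1 / 2) + 1), D * (N * (1 + (N * z) ^ 2)⁻¹) := by
          refine setIntegral_mono_on (hcont.integrableOn_Ioc) hint.integrableOn measurableSet_Ioc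
            fun z hz => hpt z (abs_le.2 ⟨hz.1.le, by linarith [hz.2]⟩)
      _ ≤ ∫ z : ℝ, D * (N * (1 + (N * z) ^ 2)⁻¹) :=
          setIntegral_le_integral hint (Eventually.of_forall fun z => by
            have : 0 ≤ D := by positivity
            simp only [Pi.zero_apply]; positivity)
      _ = D * Real.pi := by
          rw [integral_const_mul, integral_const_mul,
            Measure.integral_comp_mul_left (fun y : ℝ => (1 + y ^ 2)⁻¹) (N : ℝ),
            integral_univ_inv_one_add_sq, abs_of_pos (by positivity), smul_eq_mul]
          field_simp
  rw [intervalIntegral.integral_of_le (by linarith)] at hle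
  rw [← ofReal_integral_norm_eq_lintegral_enorm (continuous_multKernel hfin).integrableOn_Ioc]
  exact ENNReal.ofReal_le_ofReal hle

/-- The Fourier multiplier with symbol `m`. -/
def fourierMult (m : ℤ → ℝ) (u : ℝ → ℂ) : ℝ → ℂ :=
  fun x => ∑' β : ℤ, (m β : ℂ) * fourierCoeff' u β *
    Complex.exp (2 * (Real.pi : ℂ) * Complex.I * (β : ℂ) * (x : ℂ))

lemma fourierMult_eq_sum {m : ℤ → ℝ} (hm : m.support.Finite) (u : ℝ → ℂ) (x : ℝ) :
    fourierMult m u x = ∑ β ∈ hm.toFinset, (m β : ℂ) * fourierCoeff' u β *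
      Complex.exp (2 * (Real.pi : ℂ) * Complex.I * (β : ℂ) * (x : ℂ)) := by
  refine tsum_eq_sum fun β hβ => ?_
  have : m β = 0 := by simpa using hβ
  simp [this]

lemma continuous_fourierMult {m : ℤ → ℝ} (hm : m.support.Finite) (u : ℝ → ℂ) :
    Continuous (fourierMult m u) := by
  rw [funext (fourierMult_eq_sum hm u)]
  fun_prop

lemma integrableOn_mul_exp {u : ℝ → ℂ} (hu : IntegrableOn u (Set.Ioc (0 : ℝ) 1)) (β : ℤ) :
    IntegrableOn (fun x : ℝ => u x *
      Complex.exp (-(2 * (Real.pi : ℂ) * Complex.I * (β : ℂ) * (x : ℂ)))) (Set.Ioc (0 : ℝ) 1) := by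
  refine Integrable.mul_bdd (c := 1) hu (by fun_prop) (Eventually.of_forall fun x => ?_)
  have := norm_exp_two_pi_I_mul (-β) x
  rw [← this]
  refine le_of_eq ?_
  congr 2; push_cast; ring

lemma fourierCoeff'_add {u v : ℝ → ℂ} (hu : IntegrableOn u (Set.Ioc (0 : ℝ) 1))
    (hv : IntegrableOn v (Set.Ioc (0 : ℝ) 1)) (β : ℤ) :
    fourierCoeff' (fun x => u x + v x) β = fourierCoeff' u β + fourierCoeff' v β := by
  simp only [fourierCoeff', intervalIntegral.integral_of_le zero_le_one, add_mul]
  exact integral_add (integrableOn_mul_exp hu β) (integrableOn_mul_exp hv β)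

lemma fourierMult_add {m : ℤ → ℝ} (hm : m.support.Finite) {u v : ℝ → ℂ}
    (hu : IntegrableOn u (Set.Ioc (0 : ℝ) 1)) (hv : IntegrableOn v (Set.Ioc (0 : ℝ) 1)) (x : ℝ) :
    fourierMult m (fun x => u x + v x) x = fourierMult m u x + fourierMult m v x := by
  simp only [fourierMult_eq_sum hm, fourierCoeff'_add hu hv, ← Finset.sum_add_distrib]
  exact Finset.sum_congr rfl fun β _ => by ring

lemma fourierMult_eq_integral {m : ℤ → ℝ} (hm : m.support.Finite) {u : ℝ → ℂ}
    (hu : IntegrableOn u (Set.Ioc (0 : ℝ) 1)) (x : ℝ) :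
    fourierMult m u x = ∫ y in Set.Ioc (0 : ℝ) 1, multKernel m (x - y) * u y := by
  have hK : ∀ y : ℝ, multKernel m (x - y) * u y = ∑ β ∈ hm.toFinset,
      ((m β : ℂ) * Complex.exp (2 * (Real.pi : ℂ) * Complex.I * (β : ℂ) * (x : ℂ))) *
      (u y * Complex.exp (-(2 * (Real.pi : ℂ) * Complex.I * (β : ℂ) * (y : ℂ)))) := fun y => by
    have : multKernel m (x - y) = ∑ β ∈ hm.toFinset, (m β : ℂ) *
        Complex.exp (2 * (Real.pi : ℂ) * Complex.I * (β : ℂ) * ((x - y : ℝ) : ℂ)) := by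
      refine tsum_eq_sum fun β hβ => ?_
      have : m β = 0 := by simpa using hβ
      simp [this]
    rw [this, Finset.sum_mul]
    refine Finset.sum_congr rfl fun β _ => ?_
    have : Complex.exp (2 * (Real.pi : ℂ) * Complex.I * (β : ℂ) * ((x - y : ℝ) : ℂ))
        = Complex.exp (2 * (Real.pi : ℂ) * Complex.I * (β : ℂ) * (x : ℂ)) *
          Complex.exp (-(2 * (Real.pi : ℂ) * Complex.I * (β : ℂ) * (y : ℂ))) := by
      rw [← Complex.exp_add]; congr 1; push_cast; ring
    rw [this]; ring
  simp_rw [hK]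
  rw [integral_finsetSum _ fun β _ => (integrableOn_mul_exp hu β).const_mul _,
    fourierMult_eq_sum hm]
  refine Finset.sum_congr rfl fun β _ => ?_
  rw [integral_const_mul, fourierCoeff', intervalIntegral.integral_of_le zero_le_one]
  ring

/-- Young's inequality for Fourier multipliers on the circle. -/
lemma circLp_fourierMult_le {m : ℤ → ℝ} (hm : m.support.Finite) {A : ℝ≥0∞}
    (hA : ∀ a : ℝ, ∫⁻ z in Set.Ioc a (a + 1), ‖multKernel m z‖ₑ ≤ A) {u : ℝ → ℂ}
    (hu : IntegrableOn u (Set.Ioc (0 : ℝ) 1)) {p : ℝ≥0∞} (hp : 1 ≤ p) :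
    circLp p (fourierMult m u) ≤ A * circLp p u := by
  have hKm : Measurable fun z => ‖multKernel m z‖ₑ := (continuous_multKernel hm).measurable.enorm
  have h₁ : ∀ x : ℝ, ∫⁻ y in Set.Ioc (0 : ℝ) 1, ‖multKernel m (x - y)‖ₑ ≤ A := fun x => by
    have := (Measure.measurePreserving_sub_left volume x).setLIntegral_comp_preimage
      (s := Set.Ico (x - 1) (x - 1 + 1)) measurableSet_Ico hKm
    rw [Set.preimage_const_sub_Ico, sub_sub_cancel, sub_add_cancel, sub_self] at this
    rw [this, restrict_Ico_eq_restrict_Ioc]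
    simpa using hA (x - 1)
  have h₂ : ∀ y : ℝ, ∫⁻ x in Set.Ioc (0 : ℝ) 1, ‖multKernel m (x - y)‖ₑ ≤ A := fun y => by
    have := (measurePreserving_sub_right volume y).setLIntegral_comp_preimage
      (s := Set.Ioc (-y) (-y + 1)) measurableSet_Ioc hKm
    rw [Set.preimage_sub_const_Ioc, neg_add_cancel, neg_add_cancel_comm] at this
    rw [this]
    exact hA _
  have hu' : AEMeasurable (fun y => ‖u y‖ₑ) (volume.restrict (Set.Ioc (0 : ℝ) 1)) :=
    hu.aestronglyMeasurable.enorm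
  have hk : Measurable (Function.uncurry fun x y : ℝ => ‖multKernel m (x - y)‖ₑ) :=
    hKm.comp (measurable_fst.sub measurable_snd)
  have h := eLpNorm_lintegral_kernel_le hk hu' h₁ h₂ hp
  rw [eLpNorm_enorm] at h
  refine le_trans (eLpNorm_mono_enorm fun x => ?_) h
  rw [fourierMult_eq_integral hm hu, enorm_eq_self]
  refine (enorm_integral_le_lintegral_enorm _).trans_eq ?_
  simp only [enorm_mul]

lemma fourierCoeff'_coe_addCircle (F : AddCircle (1 : ℝ) → ℂ) (n : ℤ) :
    fourierCoeff' (fun x : ℝ => F x) n = fourierCoeff F n := by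
  rw [fourierCoeff_eq_intervalIntegral F n 0, fourierCoeff', zero_add, div_one, one_smul]
  refine intervalIntegral.integral_congr fun x _ => ?_
  simp only [smul_eq_mul, fourier_coe_apply]
  rw [mul_comm]
  congr 2
  push_cast; ring

lemma fourierCoeff'_exp (n β : ℤ) :
    fourierCoeff' (fun x : ℝ => Complex.exp (2 * (Real.pi : ℂ) * Complex.I * (n : ℂ) * (x : ℂ))) β
      = if β = n then 1 else 0 := by
  have := fourierCoeff'_coe_addCircle (fourier n) β
  rw [fourierCoeff_fourier, Pi.single_apply] at this
  simpa [fourier_coe_apply] using this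

lemma fourierCoeff'_fourierMult {m : ℤ → ℝ} (hm : m.support.Finite) (u : ℝ → ℂ) (β : ℤ) :
    fourierCoeff' (fourierMult m u) β = m β * fourierCoeff' u β := by
  have hexp : ∀ n : ℤ, IntegrableOn (fun x : ℝ =>
      Complex.exp (2 * (Real.pi : ℂ) * Complex.I * (n : ℂ) * (x : ℂ))) (Set.Ioc (0 : ℝ) 1) :=
    fun n => Continuous.integrableOn_Ioc (by fun_prop)
  rw [funext (fourierMult_eq_sum hm u), fourierCoeff', intervalIntegral.integral_of_le zero_le_one]
  simp only [Finset.sum_mul, mul_assoc ((m _ : ℂ) * fourierCoeff' u _)]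
  rw [integral_finsetSum _ fun n _ => (integrableOn_mul_exp (hexp n) β).const_mul _]
  have : ∀ n : ℤ, ∫ x in Set.Ioc (0 : ℝ) 1, (m n : ℂ) * fourierCoeff' u n *
      (Complex.exp (2 * (Real.pi : ℂ) * Complex.I * (n : ℂ) * (x : ℂ)) *
        Complex.exp (-(2 * (Real.pi : ℂ) * Complex.I * (β : ℂ) * (x : ℂ))))
      = if β = n then (m n : ℂ) * fourierCoeff' u n else 0 := fun n => by
    have h := fourierCoeff'_exp n β
    rw [fourierCoeff', intervalIntegral.integral_of_le zero_le_one] at h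
    rw [integral_const_mul, h, mul_ite, mul_one, mul_zero]
  simp only [this, Finset.sum_ite_eq]
  split_ifs with h
  · rfl
  · have : m β = 0 := by simpa using h
    simp [this]

/-- The Fourier coefficients of a product are the convolution of the Fourier coefficients. -/
lemma hasSum_fourierCoeff'_mul {f g : ℝ → ℂ}
    (hf : MemLp f ⊤ (volume.restrict (Set.Ioc (0 : ℝ) 1)))
    (hg : MemLp g ⊤ (volume.restrict (Set.Ioc (0 : ℝ) 1))) (β : ℤ) :
    HasSum (fun n => fourierCoeff' f n * fourierCoeff' g (β - n))
      (fourierCoeff' (fun x => f x * g x) β) := by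
  have hcoe : ∀ u : ℝ → ℂ, ∀ n, fourierCoeff (AddCircle.liftIoc 1 0 u) n = fourierCoeff' u n := by
    intro u n
    rw [← fourierCoeff'_coe_addCircle, fourierCoeff', fourierCoeff',
      intervalIntegral.integral_of_le zero_le_one, intervalIntegral.integral_of_le zero_le_one]
    refine setIntegral_congr_fun measurableSet_Ioc fun x hx => ?_
    rw [AddCircle.liftIoc_coe_apply (by simpa using hx)]
  set e : ℝ → ℂ := fun x => Complex.exp (-(2 * (Real.pi : ℂ) * Complex.I * (β : ℂ) * (x : ℂ)))
    with he
  have he1 : ∀ x, ‖e x‖ ≤ 1 := fun x => by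
    rw [← norm_exp_two_pi_I_mul (-β) x]
    refine le_of_eq ?_
    simp only [he]
    congr 2; push_cast; ring
  have hfc : MemLp (fun x => (starRingEnd ℂ) (f x)) 2 (volume.restrict (Set.Ioc (0 : ℝ) 1)) :=
    (hf.mono_exponent le_top).star
  have hge : MemLp (fun x => g x * e x) 2 (volume.restrict (Set.Ioc (0 : ℝ) 1)) := by
    refine (hg.mono_exponent le_top).of_le_mul (c := 1)
      (hg.aestronglyMeasurable.mul (by fun_prop)) (Eventually.of_forall fun x => ?_)
    rw [norm_mul, one_mul]
    exact mul_le_of_le_one_right (norm_nonneg _) (he1 x)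
  have hF : MemLp (AddCircle.liftIoc 1 0 fun x => (starRingEnd ℂ) (f x)) 2
      (AddCircle.haarAddCircle (T := 1)) :=
    memLp_haarAddCircle_iff.2 (MemLp.memLp_liftIoc (by simpa using hfc))
  have hG : MemLp (AddCircle.liftIoc 1 0 fun x => g x * e x) 2
      (AddCircle.haarAddCircle (T := 1)) :=
    memLp_haarAddCircle_iff.2 (MemLp.memLp_liftIoc (by simpa using hge))
  have key := fourierBasis.hasSum_inner_mul_inner hF.toLp hG.toLp
  have hcF : ∀ n, inner ℂ hF.toLp (fourierBasis n) = fourierCoeff' f (-n) := fun n => by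
    rw [← inner_conj_symm, ← HilbertBasis.repr_apply_apply, fourierBasis_repr,
      fourierCoeff_congr_ae hF.coeFn_toLp, hcoe, fourierCoeff', fourierCoeff',
      intervalIntegral.integral_of_le zero_le_one, intervalIntegral.integral_of_le zero_le_one,
      ← integral_conj]
    refine integral_congr_ae (Eventually.of_forall fun x => ?_)
    simp only [map_mul, Complex.conj_conj, ← Complex.exp_conj]
    congr 2
    simp [map_ofNat (starRingEnd ℂ) 2]
  have hcG : ∀ n, inner ℂ (fourierBasis n) hG.toLp = fourierCoeff' g (β + n) := fun n => by
    rw [← HilbertBasis.repr_apply_apply, fourierBasis_repr,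
      fourierCoeff_congr_ae hG.coeFn_toLp, hcoe, fourierCoeff', fourierCoeff']
    refine intervalIntegral.integral_congr fun x _ => ?_
    simp only [he, mul_assoc (g x), ← Complex.exp_add]
    congr 2
    push_cast; ring
  have hFG : inner ℂ hF.toLp hG.toLp = fourierCoeff' (fun x => f x * g x) β := by
    rw [L2.inner_def]
    have : ∀ᵐ t ∂(AddCircle.haarAddCircle (T := 1)), inner ℂ (hF.toLp _ t) (hG.toLp _ t)
        = AddCircle.liftIoc 1 0 (fun x => f x * g x * e x) t := by
      filter_upwards [hF.coeFn_toLp, hG.coeFn_toLp] with t h1 h2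
      rw [h1, h2]
      simp only [AddCircle.liftIoc, Function.comp, Set.domRestrict_apply, RCLike.inner_apply,
        Complex.conj_conj]
      ring
    rw [integral_congr_ae this, AddCircle.integral_haarAddCircle, inv_one, one_smul,
      AddCircle.integral_liftIoc_eq_intervalIntegral, zero_add, fourierCoeff']
  simp only [hcF, hcG, hFG] at key
  refine ((Equiv.neg ℤ).hasSum_iff.2 key).congr_fun fun n => ?_
  simp [sub_eq_add_neg]

lemma LPPair.summable_φ (P : LPPair) (ξ : ℝ) :
    Summable fun q : ℕ => P.φ ((2 : ℝ) ^ (-(q : ℤ)) * ξ) := by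
  have hlim : Tendsto (fun q : ℕ => (1 / 2 : ℝ) ^ q * |ξ|) atTop (nhds (0 * |ξ|)) :=
    (tendsto_pow_atTop_nhds_zero_of_lt_one (by norm_num) (by norm_num)).mul_const _
  rw [zero_mul] at hlim
  obtain ⟨N, hN⟩ := eventually_atTop.1 (hlim.eventually (gt_mem_nhds (by norm_num : (0 : ℝ) < 3 / 4)))
  refine summable_of_ne_finset_zero (s := Finset.range N) fun q hq => P.φ_supp _ (Or.inl ?_)
  have := hN q (by simpa using hq)
  rwa [abs_mul, abs_of_pos (by positivity), zpow_neg, zpow_natCast, ← inv_pow, ← one_div]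

lemma LPPair.φ_eq (P : LPPair) (ξ : ℝ) : P.φ ξ = P.χ (ξ / 2) - P.χ ξ := by
  have h1 := P.sum_one ξ
  have h2 := P.sum_one (ξ / 2)
  rw [(P.summable_φ ξ).tsum_eq_zero_add] at h1
  have : ∀ q : ℕ, P.φ ((2 : ℝ) ^ (-((q + 1 : ℕ) : ℤ)) * ξ)
      = P.φ ((2 : ℝ) ^ (-(q : ℤ)) * (ξ / 2)) := fun q => by
    congr 1
    rw [Nat.cast_succ, neg_add, zpow_add₀ two_ne_zero]
    norm_num
    ring
  simp only [this, Nat.cast_zero, neg_zero, zpow_zero, one_mul] at h1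
  linarith

lemma LPPair.χ_eq_one (P : LPPair) {ξ : ℝ} (hξ : |ξ| < 3 / 4) : P.χ ξ = 1 := by
  have h := P.sum_one ξ
  have : ∀ q : ℕ, P.φ ((2 : ℝ) ^ (-(q : ℤ)) * ξ) = 0 := fun q => by
    refine P.φ_supp _ (Or.inl (lt_of_le_of_lt ?_ hξ))
    rw [abs_mul, abs_of_pos (by positivity)]
    refine mul_le_of_le_one_left (abs_nonneg _) ?_
    rw [zpow_neg, zpow_natCast]
    exact inv_le_one_of_one_le₀ (one_le_pow₀ (by norm_num))
  simpa only [this, tsum_zero, add_zero] using h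

/-- The symbol of the low-frequency cutoff `S_{n-1} = ∑_{-1 ≤ j ≤ n-2} Δ_j`. -/
def lowPass (P : LPPair) : ℕ → ℤ → ℝ
  | 0 => fun _ => 0
  | n + 1 => fun β => P.χ (β / (2 ^ n : ℕ))

lemma lowPass_eq_zero (P : LPPair) {n : ℕ} {β : ℤ} (h : (2 : ℝ) / 3 * 2 ^ n < |(β : ℝ)|) :
    lowPass P n β = 0 := by
  cases n with
  | zero => rfl
  | succ n =>
    refine P.χ_supp _ ?_
    rw [abs_div, Nat.abs_cast, lt_div_iff₀ (by positivity)]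
    push_cast
    rw [pow_succ] at h
    linarith

lemma finite_support_of_abs_le {m : ℤ → ℝ} {R : ℝ} (h : ∀ β : ℤ, R < |(β : ℝ)| → m β = 0) :
    m.support.Finite := by
  refine (Set.finite_Icc (-⌈R⌉) ⌈R⌉).subset fun β hβ => ?_
  have hR : |(β : ℝ)| ≤ R := not_lt.1 fun hlt => hβ (h β hlt)
  rw [Set.mem_Icc, ← abs_le]
  exact_mod_cast hR.trans (Int.le_ceil R)

lemma finite_support_lowPass (P : LPPair) (n : ℕ) : (lowPass P n).support.Finite :=
  finite_support_of_abs_le fun _ => lowPass_eq_zero P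

lemma LPcutoff_sub_one (P : LPPair) (n : ℕ) (β : ℤ) :
    LPcutoff P (n - 1) β = lowPass P (n + 1) β - lowPass P n β := by
  cases n with
  | zero => simp [LPcutoff, lowPass]
  | succ n =>
    have h1 : ((n + 1 : ℕ) : ℤ) - 1 = n := by push_cast; ring
    rw [h1, LPcutoff, if_neg (by omega), if_pos (by omega), P.φ_eq]
    simp only [lowPass]
    congr 2
    · rw [zpow_neg, zpow_natCast]; push_cast; field_simp; ring
    · rw [zpow_neg, zpow_natCast]; push_cast; field_simp

lemma finite_support_LPcutoff (P : LPPair) (n : ℕ) : (LPcutoff P (n - 1)).support.Finite := by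
  refine ((finite_support_lowPass P (n + 1)).union (finite_support_lowPass P n)).subset
    fun β hβ => ?_
  by_contra h
  simp only [Set.mem_union, Function.mem_support, not_or, not_not] at h
  exact hβ (by rw [LPcutoff_sub_one, h.1, h.2, sub_zero])

lemma LPcutoff_eq_zero_of_abs_lt (P : LPPair) {n : ℕ} (hn : 0 < n) {β : ℤ}
    (h : |(β : ℝ)| < 3 / 8 * 2 ^ n) : LPcutoff P (n - 1) β = 0 := by
  obtain ⟨n, rfl⟩ := Nat.exists_eq_succ_of_ne_zero hn.ne'
  rw [pow_succ] at h
  have h1 : (0 : ℝ) < 2 ^ n := by positivity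
  have e : ∀ k : ℕ, 0 < k → |(β : ℝ)| < 3 / 4 * k → P.χ (β / k) = 1 := fun k hk hb =>
    P.χ_eq_one (by
      rw [abs_div, Nat.abs_cast, div_lt_iff₀ (by exact_mod_cast hk)]
      exact hb)
  rw [LPcutoff_sub_one]
  simp only [lowPass]
  rw [e _ (by positivity), e _ (by positivity), sub_self]
  · push_cast; linarith
  · push_cast; rw [pow_succ]; linarith

lemma tendsto_lowPass (P : LPPair) (β : ℤ) :
    Tendsto (fun n => lowPass P n β) atTop (nhds 1) := by
  refine tendsto_const_nhds.congr' ?_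
  have hlim : Tendsto (fun n : ℕ => (2 : ℝ) ^ n) atTop atTop :=
    tendsto_pow_atTop_atTop_of_one_lt one_lt_two
  filter_upwards [hlim.eventually_gt_atTop (|(β : ℝ)| * 8 / 3), eventually_gt_atTop 0] with n hn h0
  obtain ⟨n, rfl⟩ := Nat.exists_eq_succ_of_ne_zero h0.ne'
  refine (P.χ_eq_one ?_).symm
  rw [abs_div, Nat.abs_cast, div_lt_iff₀ (by positivity)]
  push_cast
  rw [pow_succ] at hn
  linarith

lemma LPPair.hasCompactSupport_χ (P : LPPair) : HasCompactSupport P.χ := by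
  refine HasCompactSupport.intro (isCompact_closedBall (0 : ℝ) (4 / 3)) fun ξ hξ => P.χ_supp ξ ?_
  simpa using hξ

lemma exists_abs_lowPass_le (P : LPPair) : ∃ B : ℝ, ∀ n β, |lowPass P n β| ≤ B := by
  obtain ⟨B, hB⟩ := P.hasCompactSupport_χ.exists_bound_of_continuous P.χ_smooth.continuous
  refine ⟨B, fun n β => ?_⟩
  cases n with
  | zero => simpa [lowPass] using (norm_nonneg _).trans (hB 0)
  | succ n => exact hB _

lemma exists_lintegral_lowPass_le (P : LPPair) : ∃ A : ℝ≥0∞, A ≠ ⊤ ∧ ∀ n a,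
    ∫⁻ z in Set.Ioc a (a + 1), ‖multKernel (lowPass P n) z‖ₑ ≤ A := by
  obtain ⟨A, hA⟩ := exists_lintegral_multKernel_dilation_le P.χ_smooth P.χ_supp
  refine ⟨ENNReal.ofReal A, ENNReal.ofReal_ne_top, fun n a => ?_⟩
  cases n with
  | zero => simp [lowPass, multKernel]
  | succ n => exact hA (2 ^ n) (by positivity) a

lemma multKernel_LPcutoff (P : LPPair) (n : ℕ) (z : ℝ) :
    multKernel (LPcutoff P (n - 1)) z
      = multKernel (lowPass P (n + 1)) z - multKernel (lowPass P n) z := by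
  rw [multKernel, multKernel, multKernel, ← (summable_multKernel (finite_support_lowPass P _) z).tsum_sub
    (summable_multKernel (finite_support_lowPass P _) z)]
  refine tsum_congr fun β => ?_
  rw [LPcutoff_sub_one]; push_cast; ring

lemma lintegral_LPcutoff_le (P : LPPair) {A : ℝ≥0∞}
    (hA : ∀ n a, ∫⁻ z in Set.Ioc a (a + 1), ‖multKernel (lowPass P n) z‖ₑ ≤ A) (n : ℕ) (a : ℝ) :
    ∫⁻ z in Set.Ioc a (a + 1), ‖multKernel (LPcutoff P (n - 1)) z‖ₑ ≤ 2 * A := by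
  calc _ ≤ ∫⁻ z in Set.Ioc a (a + 1),
        (‖multKernel (lowPass P (n + 1)) z‖ₑ + ‖multKernel (lowPass P n) z‖ₑ) := by
        refine lintegral_mono fun z => ?_
        rw [multKernel_LPcutoff]
        exact enorm_sub_le
    _ ≤ A + A := by
        rw [lintegral_add_left (continuous_multKernel (finite_support_lowPass P _)).measurable.enorm]
        exact add_le_add (hA _ _) (hA _ _)
    _ = 2 * A := (two_mul A).symm

lemma fourierMult_lowPass_succ (P : LPPair) (n : ℕ) (u : ℝ → ℂ) (x : ℝ) :
    fourierMult (lowPass P (n + 1)) u x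
      = fourierMult (lowPass P n) u x + LPblock P (n - 1) u x := by
  have hs : ∀ {m : ℤ → ℝ}, m.support.Finite → Summable fun β : ℤ => (m β : ℂ) * fourierCoeff' u β *
      Complex.exp (2 * (Real.pi : ℂ) * Complex.I * (β : ℂ) * (x : ℂ)) := fun hm =>
    summable_of_hasFiniteSupport (hm.subset fun β hβ h => hβ (by simp [h]))
  have := (hs (finite_support_lowPass P n)).tsum_add (hs (finite_support_LPcutoff P n))
  refine Eq.trans (tsum_congr fun β => ?_) this
  rw [LPcutoff_sub_one]; push_cast; ring

lemma memLp_top_of_continuous {u : ℝ → ℂ} (hu : Continuous u) :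
    MemLp u ⊤ (volume.restrict (Set.Ioc (0 : ℝ) 1)) := by
  obtain ⟨B, hB⟩ := (isCompact_Icc (a := (0 : ℝ)) (b := 1)).exists_bound_of_continuousOn
    hu.continuousOn
  refine memLp_top_of_bound hu.aestronglyMeasurable B ?_
  filter_upwards [ae_restrict_mem measurableSet_Ioc] with x hx
  exact hB x (Set.Ioc_subset_Icc_self hx)

/-- Fourier support of a product of low-frequency parts. -/
lemma LPblock_mul_lowPass_eq_zero (P : LPPair) {n m : ℕ} (h : m + 2 ≤ n ∨ m = 0) (f g : ℝ → ℂ)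
    (x : ℝ) :
    LPblock P (n - 1)
      (fun x => fourierMult (lowPass P m) f x * fourierMult (lowPass P m) g x) x = 0 := by
  have hbdd : ∀ u : ℝ → ℂ, MemLp (fourierMult (lowPass P m) u) ⊤
      (volume.restrict (Set.Ioc (0 : ℝ) 1)) := fun u =>
    memLp_top_of_continuous (continuous_fourierMult (finite_support_lowPass P m) u)
  have hzero : ∀ β : ℤ, (LPcutoff P (n - 1) β : ℂ) * fourierCoeff' (fun x =>
      fourierMult (lowPass P m) f x * fourierMult (lowPass P m) g x) β = 0 := fun β => by
    by_cases hc : LPcutoff P (n - 1) β = 0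
    · simp [hc]
    rw [← (hasSum_fourierCoeff'_mul (hbdd f) (hbdd g) β).tsum_eq]
    simp only [fourierCoeff'_fourierMult (finite_support_lowPass P m)]
    have : ∀ k : ℤ, lowPass P m k = 0 ∨ lowPass P m (β - k) = 0 := fun k => by
      rcases h with h | rfl
      · by_contra! hk
        have h1 := not_lt.1 fun hh => hk.1 (lowPass_eq_zero P hh)
        have h2 := not_lt.1 fun hh => hk.2 (lowPass_eq_zero P hh)
        refine hc (LPcutoff_eq_zero_of_abs_lt P (by omega) ?_)
        have h3 : (2 : ℝ) ^ (m + 2) ≤ 2 ^ n := pow_le_pow_right₀ (by norm_num) h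
        rw [pow_add] at h3
        have h4 := abs_add_le (k : ℝ) ((β - k : ℤ) : ℝ)
        push_cast at h2 h4
        rw [add_sub_cancel] at h4
        have : (0 : ℝ) < 2 ^ m := by positivity
        linarith
      · left; rfl
    have hz : ∀ k : ℤ, (lowPass P m k : ℂ) * fourierCoeff' f k *
        (lowPass P m (β - k) * fourierCoeff' g (β - k)) = 0 := fun k => by
      rcases this k with h | h <;> simp [h]
    simp [hz]
  rw [LPblock, LPblockC]
  simp [hzero]

lemma circLp_mul_le_left (p : ℝ≥0∞) {u : ℝ → ℂ} (hu : Continuous u) (v : ℝ → ℂ) :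
    circLp p (fun x => u x * v x) ≤ circLp p u * circLp ⊤ v := by
  have h := eLpNorm_smul_le_eLpNorm_mul_eLpNorm_top (μ := volume.restrict (Set.Ioc (0 : ℝ) 1))
    p v (φ := u) hu.aestronglyMeasurable
  exact h

lemma circLp_add_le {p : ℝ≥0∞} (hp : 1 ≤ p) {u v : ℝ → ℂ} (hu : Continuous u) (hv : Continuous v) :
    circLp p (fun x => u x + v x) ≤ circLp p u + circLp p v :=
  eLpNorm_add_le hu.aestronglyMeasurable hv.aestronglyMeasurable hp

lemma circLp_LPblock_add_mul_le (P : LPPair) {A : ℝ≥0∞}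
    (hA : ∀ n a, ∫⁻ z in Set.Ioc a (a + 1), ‖multKernel (lowPass P n) z‖ₑ ≤ A)
    {p : ℝ≥0∞} (hp : 1 ≤ p) {w d u e v : ℝ → ℂ} (hw : Continuous w) (hd : Continuous d)
    (hu : Continuous u) (he : Continuous e) (hv : Continuous v) (n : ℕ) :
    circLp p (LPblock P (n - 1) (fun x => w x + (d x * u x + e x * v x))) ≤
      circLp p (LPblock P (n - 1) w) +
        2 * A * (circLp p d * circLp ⊤ u + circLp p e * circLp ⊤ v) := by
  have h1 : Continuous fun x => d x * u x := hd.mul hu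
  have h2 : Continuous fun x => e x * v x := he.mul hv
  have h3 : Continuous fun x => d x * u x + e x * v x := h1.add h2
  have hadd : LPblock P (n - 1) (fun x => w x + (d x * u x + e x * v x))
      = fun x => LPblock P (n - 1) w x + LPblock P (n - 1) (fun x => d x * u x + e x * v x) x :=
    funext (fourierMult_add (finite_support_LPcutoff P n) hw.integrableOn_Ioc h3.integrableOn_Ioc)
  have hc : ∀ y, Continuous (LPblock P (n - 1) y) := fun y =>
    continuous_fourierMult (finite_support_LPcutoff P n) y
  rw [hadd]
  refine (circLp_add_le hp (hc _) (hc _)).trans (add_le_add_right ?_ _)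
  refine (circLp_fourierMult_le (finite_support_LPcutoff P n) (lintegral_LPcutoff_le P hA n)
    h3.integrableOn_Ioc hp).trans (mul_le_mul_right ?_ _)
  exact (circLp_add_le hp h1 h2).trans
    (add_le_add (circLp_mul_le_left p hd _) (circLp_mul_le_left p he _))

/-- Telescoping bound for a Littlewood–Paley block of a product of low-frequency parts. -/
lemma circLp_LPblock_lowPass_mul_le (P : LPPair) {A : ℝ≥0∞}
    (hA : ∀ n a, ∫⁻ z in Set.Ioc a (a + 1), ‖multKernel (lowPass P n) z‖ₑ ≤ A)
    {p : ℝ≥0∞} (hp : 1 ≤ p) {f g : ℝ → ℂ} (hf : IntegrableOn f (Set.Ioc (0 : ℝ) 1))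
    (hg : IntegrableOn g (Set.Ioc (0 : ℝ) 1)) (n J : ℕ) :
    circLp p (LPblock P (n - 1)
        (fun x => fourierMult (lowPass P J) f x * fourierMult (lowPass P J) g x)) ≤
      ∑ m ∈ Finset.range J, if n ≤ m + 2 then
        2 * A * (A * (circLp p (LPblock P (m - 1) f) * circLp ⊤ g +
          circLp p (LPblock P (m - 1) g) * circLp ⊤ f)) else 0 := by
  have hz : ∀ m : ℕ, (m + 2 ≤ n ∨ m = 0) → circLp p (LPblock P (n - 1)
      (fun x => fourierMult (lowPass P m) f x * fourierMult (lowPass P m) g x)) = 0 := fun m h => by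
    rw [funext (LPblock_mul_lowPass_eq_zero P h f g)]
    exact eLpNorm_zero
  induction J with
  | zero => simp [hz 0 (Or.inr rfl)]
  | succ J ih =>
    by_cases hJ : J + 1 + 2 ≤ n
    · rw [hz _ (Or.inl hJ)]; exact zero_le
    rw [Finset.sum_range_succ, if_pos (by omega)]
    have cS : ∀ k u, Continuous (fourierMult (lowPass P k) u) := fun k u =>
      continuous_fourierMult (finite_support_lowPass P k) u
    have cD : ∀ (k : ℕ) u, Continuous (LPblock P (k - 1) u) := fun k u =>
      continuous_fourierMult (finite_support_LPcutoff P k) u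
    have hsplit : (fun x => fourierMult (lowPass P (J + 1)) f x *
        fourierMult (lowPass P (J + 1)) g x) = fun x =>
          fourierMult (lowPass P J) f x * fourierMult (lowPass P J) g x +
          (LPblock P (J - 1) f x * fourierMult (lowPass P (J + 1)) g x +
            LPblock P (J - 1) g x * fourierMult (lowPass P J) f x) := by
      funext x
      simp only [fourierMult_lowPass_succ P J]
      ring
    rw [hsplit]
    refine (circLp_LPblock_add_mul_le P hA hp ((cS _ _).mul (cS _ _)) (cD _ _) (cS _ _) (cD _ _)
      (cS _ _) n).trans (add_le_add ih (mul_le_mul_right ?_ _))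
    rw [mul_add, mul_left_comm A, mul_left_comm A]
    exact add_le_add
      (mul_le_mul_right (circLp_fourierMult_le (finite_support_lowPass P _) (hA _) hg le_top) _)
      (mul_le_mul_right (circLp_fourierMult_le (finite_support_lowPass P _) (hA _) hf le_top) _)

lemma tendsto_fourierCoeff'_lowPass_mul (P : LPPair) {f g : ℝ → ℂ}
    (hf : MemLp f ⊤ (volume.restrict (Set.Ioc (0 : ℝ) 1)))
    (hg : MemLp g ⊤ (volume.restrict (Set.Ioc (0 : ℝ) 1))) (β : ℤ) :
    Tendsto (fun J => fourierCoeff' (fun x => fourierMult (lowPass P J) f x *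
      fourierMult (lowPass P J) g x) β) atTop (nhds (fourierCoeff' (fun x => f x * g x) β)) := by
  obtain ⟨B, hB⟩ := exists_abs_lowPass_le P
  have hB0 : 0 ≤ B := (abs_nonneg _).trans (hB 0 0)
  have hbdd : ∀ J (u : ℝ → ℂ), MemLp (fourierMult (lowPass P J) u) ⊤
      (volume.restrict (Set.Ioc (0 : ℝ) 1)) := fun J u =>
    memLp_top_of_continuous (continuous_fourierMult (finite_support_lowPass P J) u)
  have hsum := hasSum_fourierCoeff'_mul hf hg β
  rw [← hsum.tsum_eq]
  simp only [← fun J => (hasSum_fourierCoeff'_mul (hbdd J f) (hbdd J g) β).tsum_eq,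
    fourierCoeff'_fourierMult (finite_support_lowPass P _)]
  refine tendsto_tsum_of_dominated_convergence
    (bound := fun k => B * B * ‖fourierCoeff' f k * fourierCoeff' g (β - k)‖)
    (hsum.summable.norm.mul_left _) (fun k => ?_) (Eventually.of_forall fun J k => ?_)
  · have h1 : Tendsto (fun J => (lowPass P J k : ℂ)) atTop (nhds 1) := by
      exact_mod_cast (Complex.continuous_ofReal.tendsto 1).comp (tendsto_lowPass P k)
    have h2 : Tendsto (fun J => (lowPass P J (β - k) : ℂ)) atTop (nhds 1) := by
      exact_mod_cast (Complex.continuous_ofReal.tendsto 1).comp (tendsto_lowPass P (β - k))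
    simpa using (h1.mul_const (fourierCoeff' f k)).mul (h2.mul_const (fourierCoeff' g (β - k)))
  · rw [mul_mul_mul_comm, norm_mul, norm_mul (lowPass P J k : ℂ), Complex.norm_real,
      Complex.norm_real]
    gcongr
    · exact hB J k
    · exact hB J (β - k)

lemma circLp_LPblock_mul_le (P : LPPair) {A : ℝ≥0∞}
    (hA : ∀ n a, ∫⁻ z in Set.Ioc a (a + 1), ‖multKernel (lowPass P n) z‖ₑ ≤ A)
    {p : ℝ≥0∞} (hp : 1 ≤ p) {f g : ℝ → ℂ}
    (hf : MemLp f ⊤ (volume.restrict (Set.Ioc (0 : ℝ) 1)))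
    (hg : MemLp g ⊤ (volume.restrict (Set.Ioc (0 : ℝ) 1))) (n : ℕ) :
    circLp p (LPblock P (n - 1) (fun x => f x * g x)) ≤
      ∑' m : ℕ, if n ≤ m + 2 then
        2 * A * (A * (circLp p (LPblock P (m - 1) f) * circLp ⊤ g +
          circLp p (LPblock P (m - 1) g) * circLp ⊤ f)) else 0 := by
  have hlim : ∀ x, Tendsto (fun J => LPblock P (n - 1) (fun x => fourierMult (lowPass P J) f x *
      fourierMult (lowPass P J) g x) x) atTop (nhds (LPblock P (n - 1) (fun x => f x * g x) x)) := by
    intro x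
    simp only [fun u : ℝ → ℂ => fourierMult_eq_sum (finite_support_LPcutoff P n) u x,
      show LPblock P (n - 1) = fourierMult (LPcutoff P (n - 1)) from rfl]
    exact tendsto_finsetSum _ fun β _ =>
      ((tendsto_fourierCoeff'_lowPass_mul P hf hg β).const_mul _).mul_const _
  refine (Lp.eLpNorm_lim_le_liminf_eLpNorm (fun J => (continuous_fourierMult
    (finite_support_LPcutoff P n) _).aestronglyMeasurable) _
    (Eventually.of_forall hlim)).trans ?_
  refine liminf_le_of_frequently_le' (Frequently.of_forall fun J => ?_)
  exact (circLp_LPblock_lowPass_mul_le P hA hp (hf.integrable le_top) (hg.integrable le_top)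
    n J).trans (ENNReal.sum_le_tsum _)

lemma besovNorm_eq_eLpNorm (P : LPPair) (s : ℝ) (p : ℝ≥0∞) {r : ℝ≥0∞} (hr : 1 ≤ r) (u : ℝ → ℂ) :
    besovNorm P s p r u = eLpNorm (fun q : ℤ =>
      ENNReal.ofReal ((2 : ℝ) ^ ((q : ℝ) * s)) * circLp p (LPblock P q u)) r Measure.count := by
  rw [besovNorm, besovNormC]
  split_ifs with h
  · subst h
    simp [LPblock]
  · rw [eLpNorm_eq_lintegral_rpow_enorm_toReal (zero_lt_one.trans_le hr).ne' h, lintegral_count]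
    simp [LPblock]

/-- The summation kernel `2^{(q-j)s} 1_{q ≤ j + 2}`. -/
def dyadicKernel (s : ℝ) (q j : ℤ) : ℝ≥0∞ :=
  if q ≤ j + 2 then ENNReal.ofReal ((2 : ℝ) ^ (((q : ℝ) - j) * s)) else 0

lemma exists_tsum_dyadicKernel_le {s : ℝ} (hs : 0 < s) : ∃ K : ℝ≥0∞, K ≠ ⊤ ∧
    (∀ q, ∑' j, dyadicKernel s q j ≤ K) ∧ ∀ j, ∑' q, dyadicKernel s q j ≤ K := by
  set h : ℤ → ℝ≥0∞ := fun i => if i ≤ 2 then ENNReal.ofReal ((2 : ℝ) ^ ((i : ℝ) * s)) else 0 with hh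
  have hk : ∀ q j, dyadicKernel s q j = h (q - j) := fun q j => by
    simp only [dyadicKernel, hh, Int.cast_sub]
    congr 1
    exact propext ⟨fun _ => by omega, fun _ => by omega⟩
  refine ⟨∑' i, h i, ?_, fun q => ?_, fun j => ?_⟩
  · have hinj : Function.Injective fun l : ℕ => (2 : ℤ) - l := fun a b hab => by
      simp only at hab; omega
    rw [← hinj.tsum_eq]
    · have : ∀ l : ℕ, h (2 - l)
          = ENNReal.ofReal ((2 : ℝ) ^ (2 * s) * ((2 : ℝ) ^ (-s)) ^ l) := fun l => by
        simp only [hh]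
        rw [if_pos (by omega), ← Real.rpow_natCast, ← Real.rpow_mul two_pos.le,
          ← Real.rpow_add two_pos]
        congr 2; push_cast; ring
      simp only [this]
      refine Summable.tsum_ofReal_ne_top (Summable.mul_left _ ?_)
      exact summable_geometric_of_lt_one (by positivity)
        (Real.rpow_lt_one_of_one_lt_of_neg one_lt_two (by linarith))
    · intro i hi
      have : i ≤ 2 := by
        by_contra hc
        exact hi (by simp only [hh, if_neg hc])
      exact ⟨(2 - i).toNat, by simp only; omega⟩
  · simp only [hk]
    exact ((Equiv.subLeft q).tsum_eq h).le
  · simp only [hk]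
    exact ((Equiv.subRight j).tsum_eq h).le

/-- Weighted block estimate for a product. -/
lemma weighted_circLp_LPblock_mul_le (P : LPPair) (s : ℝ) {A : ℝ≥0∞}
    (hA : ∀ n a, ∫⁻ z in Set.Ioc a (a + 1), ‖multKernel (lowPass P n) z‖ₑ ≤ A)
    {p : ℝ≥0∞} (hp : 1 ≤ p) {f g : ℝ → ℂ}
    (hf : MemLp f ⊤ (volume.restrict (Set.Ioc (0 : ℝ) 1)))
    (hg : MemLp g ⊤ (volume.restrict (Set.Ioc (0 : ℝ) 1))) (q : ℤ) :
    ENNReal.ofReal ((2 : ℝ) ^ ((q : ℝ) * s)) * circLp p (LPblock P q fun x => f x * g x) ≤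
      (∑' j : ℤ, 2 * A * A * circLp ⊤ g * dyadicKernel s q j *
        (ENNReal.ofReal ((2 : ℝ) ^ ((j : ℝ) * s)) * circLp p (LPblock P j f))) +
      ∑' j : ℤ, 2 * A * A * circLp ⊤ f * dyadicKernel s q j *
        (ENNReal.ofReal ((2 : ℝ) ^ ((j : ℝ) * s)) * circLp p (LPblock P j g)) := by
  by_cases hq : q < -1
  · have : LPblock P q (fun x => f x * g x) = 0 := by
      funext x
      have : ∀ β, LPcutoff P q β = 0 := fun β => by
        rw [LPcutoff, if_neg (by omega), if_neg (by omega)]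
      simp [LPblock, LPblockC, this]
    rw [this, circLp, eLpNorm_zero, mul_zero]
    exact zero_le
  obtain ⟨n, rfl⟩ : ∃ n : ℕ, q = n - 1 := ⟨(q + 1).toNat, by omega⟩
  rw [← ENNReal.tsum_add]
  have hinj : Function.Injective fun m : ℕ => (m : ℤ) - 1 := fun a b hab => by
    simp only at hab; omega
  refine le_trans ?_ (ENNReal.tsum_comp_le_tsum_of_injective hinj _)
  refine (mul_le_mul_right (circLp_LPblock_mul_le P hA hp hf hg n) _).trans ?_
  rw [← ENNReal.tsum_mul_left]
  refine ENNReal.tsum_le_tsum fun m => ?_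
  by_cases h : n ≤ m + 2
  · have hd : ENNReal.ofReal ((2 : ℝ) ^ ((((n : ℤ) - 1 : ℤ) : ℝ) * s))
        = dyadicKernel s (n - 1) (m - 1) *
          ENNReal.ofReal ((2 : ℝ) ^ ((((m : ℤ) - 1 : ℤ) : ℝ) * s)) := by
      rw [dyadicKernel, if_pos (by omega), ← ENNReal.ofReal_mul (by positivity),
        ← Real.rpow_add two_pos]
      congr 2; ring
    rw [if_pos h, hd]
    exact le_of_eq (by ring)
  · rw [if_neg h, mul_zero]
    exact zero_le

lemma eLpNorm_dyadicKernel_le {s : ℝ} {K : ℝ≥0∞} (h₁ : ∀ q, ∑' j, dyadicKernel s q j ≤ K)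
    (h₂ : ∀ j, ∑' q, dyadicKernel s q j ≤ K) {r : ℝ≥0∞} (hr : 1 ≤ r) (c : ℝ≥0∞) (v : ℤ → ℝ≥0∞) :
    eLpNorm (fun q => ∑' j, c * dyadicKernel s q j * v j) r Measure.count
      ≤ c * K * eLpNorm v r Measure.count := by
  have := eLpNorm_lintegral_kernel_le (μ := Measure.count) (ν := Measure.count)
    (k := fun q j => c * dyadicKernel s q j) (v := v) (A := c * K) (measurable_of_countable _)
    (measurable_of_countable v).aemeasurable
    (fun q => by rw [lintegral_count, ENNReal.tsum_mul_left]; gcongr; exact h₁ q)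
    (fun j => by rw [lintegral_count, ENNReal.tsum_mul_left]; gcongr; exact h₂ j) hr
  simpa only [lintegral_count] using this

/-- (1-D Moser-type estimate) Let `s > 0` and `1 ≤ p, r ≤ ∞`. There is a
constant `C` such that for all `f, g ∈ B^s_{p,r}(S) ∩ L^∞(S)`,
`‖fg‖_{B^s_{p,r}} ≤ C(‖f‖_{B^s_{p,r}}‖g‖_{L^∞} + ‖g‖_{B^s_{p,r}}‖f‖_{L^∞})`. -/
theorem moser_product_estimate (P : LPPair) (s : ℝ) (p r : ℝ≥0∞)
    (hs : 0 < s) (hp : 1 ≤ p) (hr : 1 ≤ r) :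
    ∃ C : ℝ≥0∞, 0 < C ∧ C < ⊤ ∧ ∀ f g : ℝ → ℂ,
      MemBesov P s p r f → MemBesov P s p r g →
      circLp ⊤ f < ⊤ → circLp ⊤ g < ⊤ →
      besovNorm P s p r (fun x => f x * g x)
        ≤ C * (besovNorm P s p r f * circLp ⊤ g + besovNorm P s p r g * circLp ⊤ f) := by
  obtain ⟨A, hAt, hA⟩ := exists_lintegral_lowPass_le P
  obtain ⟨K, hKt, h₁, h₂⟩ := exists_tsum_dyadicKernel_le hs
  refine ⟨2 * A * A * K + 1, by positivity, by finiteness, fun f g hf hg hfb hgb => ?_⟩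
  have hf' : MemLp f ⊤ (volume.restrict (Set.Ioc (0 : ℝ) 1)) :=
    ⟨((intervalIntegrable_iff_integrableOn_Ioc_of_le zero_le_one).1
      (hf.2.1 0 1)).aestronglyMeasurable, hfb⟩
  have hg' : MemLp g ⊤ (volume.restrict (Set.Ioc (0 : ℝ) 1)) :=
    ⟨((intervalIntegrable_iff_integrableOn_Ioc_of_le zero_le_one).1
      (hg.2.1 0 1)).aestronglyMeasurable, hgb⟩
  simp only [besovNorm_eq_eLpNorm P s p hr]
  refine (eLpNorm_mono_enorm fun q => ?_).trans ((eLpNorm_add_le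
    (measurable_of_countable _).aestronglyMeasurable
    (measurable_of_countable _).aestronglyMeasurable hr).trans
      ((add_le_add (eLpNorm_dyadicKernel_le h₁ h₂ hr (2 * A * A * circLp ⊤ g)
          fun j => ENNReal.ofReal ((2 : ℝ) ^ ((j : ℝ) * s)) * circLp p (LPblock P j f))
        (eLpNorm_dyadicKernel_le h₁ h₂ hr (2 * A * A * circLp ⊤ f)
          fun j => ENNReal.ofReal ((2 : ℝ) ^ ((j : ℝ) * s)) * circLp p (LPblock P j g))).trans ?_))
  · simp only [enorm_eq_self, Pi.add_apply]
    exact weighted_circLp_LPblock_mul_le P s hA hp hf' hg' q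
  · refine le_trans (le_of_eq ?_) (mul_le_mul_left le_self_add _)
    ring

end
end

section
/- Let (u, ρ) with u ∈ C([0,T); H^s) ∩ C¹([0,T); H^{s-1}), ρ ∈ C([0,T); H^{s-1}) ∩ C¹([0,T); H^{s-2}), s > 3/2, solve ρ_t - (u + 2γ₂)ρ_x = u_x ρ, and let q solve q_t = u(t,-q) + 2γ₂, q(0,x) = x. Then ρ(t, -q(t,x)) q_x(t,x) = ρ₀(-x) for all (t,x) ∈ [0,T) × S. -/
open MeasureTheory Filter Set
open scoped ENNReal NNReal

noncomputable section

/-- The `β`-th Fourier coefficient of a 1-periodic function `f : ℝ → ℝ`. -/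
def fourierCoeffR (f : ℝ → ℝ) (β : ℤ) : ℂ :=
  ∫ x in (0:ℝ)..1, (f x : ℂ) * Complex.exp (-(2 * (Real.pi : ℂ) * Complex.I * (β : ℂ) * (x : ℂ)))

/-- The squared periodic Sobolev norm `‖f‖_{H^s(S)}² = ∑_β (1+β²)^s |f̂(β)|²`. -/
def sobNormSq (s : ℝ) (f : ℝ → ℝ) : ℝ≥0∞ :=
  ∑' β : ℤ, ENNReal.ofReal ((1 + (β:ℝ) ^ 2) ^ s * ‖fourierCoeffR f β‖ ^ 2)

/-- `u : [0,T) → H^s(S)` continuously: each `u(t)` is 1-periodic, lies in `H^s`, and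
`t ↦ u(t)` is continuous into `H^s`. -/
def ContIntoHs (T s : ℝ) (u : ℝ → ℝ → ℝ) : Prop :=
  (∀ t ∈ Ico 0 T, Function.Periodic (u t) 1) ∧
  (∀ t ∈ Ico 0 T, sobNormSq s (u t) < ⊤) ∧
  (∀ t₀ ∈ Ico 0 T, Tendsto (fun t => sobNormSq s (fun x => u t x - u t₀ x))
    (nhdsWithin t₀ (Ico 0 T)) (nhds 0))

/-- `u ∈ C¹([0,T); H^{s}(S))`: there is a time derivative `v` which is continuous
into `H^{s}` and is the pointwise `t`-derivative of `u`. -/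
def C1IntoHs (T s : ℝ) (u : ℝ → ℝ → ℝ) : Prop :=
  ∃ v : ℝ → ℝ → ℝ, ContIntoHs T s v ∧
    ∀ x : ℝ, ∀ t ∈ Ico 0 T, HasDerivAt (fun τ => u τ x) (v t x) t


theorem summable_one_add_sq_rpow {τ : ℝ} (hτ : 1 / 2 < τ) :
    Summable fun β : ℤ => (1 + (β : ℝ) ^ 2) ^ (-τ) := by
  refine Summable.of_norm_bounded_eventually
    (Real.summable_abs_int_rpow (b := 2 * τ) (by linarith)) ?_
  filter_upwards [(Set.finite_singleton (0 : ℤ)).compl_mem_cofinite] with β hβ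
  have hβ0 : 0 < |(β : ℝ)| := abs_pos.2 (by exact_mod_cast hβ)
  rw [Real.norm_of_nonneg (by positivity), ← mul_neg, Real.rpow_mul hβ0.le]
  refine Real.rpow_le_rpow_of_nonpos (by positivity) ?_ (by linarith)
  rw [Real.rpow_two, sq_abs]
  linarith

/-- Cauchy-Schwarz: the `H^σ` norm controls the `ℓ¹` norm of the Fourier coefficients with weight
`(1 + β²)^((σ - τ) / 2)`, for every `τ > 1/2`. -/
theorem tsum_weighted_fourierCoeffR_le {σ τ : ℝ} (hτ : 1 / 2 < τ) {f : ℝ → ℝ}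
    (hf : sobNormSq σ f < ⊤) :
    (Summable fun β : ℤ => (1 + (β : ℝ) ^ 2) ^ ((σ - τ) / 2) * ‖fourierCoeffR f β‖) ∧
    ∑' β : ℤ, (1 + (β : ℝ) ^ 2) ^ ((σ - τ) / 2) * ‖fourierCoeffR f β‖ ≤
      √(∑' β : ℤ, (1 + (β : ℝ) ^ 2) ^ (-τ)) * √((sobNormSq σ f).toReal) := by
  have hsum : Summable fun β : ℤ => (1 + (β : ℝ) ^ 2) ^ σ * ‖fourierCoeffR f β‖ ^ 2 := by
    have := ENNReal.summable_toReal hf.ne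
    refine this.congr fun β => ?_
    rw [ENNReal.toReal_ofReal (by positivity)]
  have hnorm : (sobNormSq σ f).toReal =
      ∑' β : ℤ, (1 + (β : ℝ) ^ 2) ^ σ * ‖fourierCoeffR f β‖ ^ 2 := by
    rw [sobNormSq, ← ENNReal.ofReal_tsum_of_nonneg (fun β => by positivity) hsum,
      ENNReal.toReal_ofReal (tsum_nonneg fun β => by positivity)]
  have e1 : ∀ β : ℤ, ((1 + (β : ℝ) ^ 2) ^ (-τ / 2)) ^ (2 : ℝ) = (1 + (β : ℝ) ^ 2) ^ (-τ) :=
    fun β => by rw [← Real.rpow_mul (by positivity)]; ring_nf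
  have e2 : ∀ β : ℤ, ((1 + (β : ℝ) ^ 2) ^ (σ / 2) * ‖fourierCoeffR f β‖) ^ (2 : ℝ) =
      (1 + (β : ℝ) ^ 2) ^ σ * ‖fourierCoeffR f β‖ ^ 2 := fun β => by
    rw [Real.mul_rpow (by positivity) (by positivity), ← Real.rpow_mul (by positivity),
      Real.rpow_two, div_mul_cancel₀ _ two_ne_zero]
  have e3 : ∀ β : ℤ, (1 + (β : ℝ) ^ 2) ^ ((σ - τ) / 2) * ‖fourierCoeffR f β‖ =
      (1 + (β : ℝ) ^ 2) ^ (-τ / 2) * ((1 + (β : ℝ) ^ 2) ^ (σ / 2) * ‖fourierCoeffR f β‖) :=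
    fun β => by
      rw [← mul_assoc, ← Real.rpow_add (by positivity)]
      ring_nf
  have h := Real.summable_and_inner_le_Lp_mul_Lq_tsum_of_nonneg Real.HolderConjugate.two_two
    (f := fun β : ℤ => (1 + (β : ℝ) ^ 2) ^ (-τ / 2))
    (g := fun β : ℤ => (1 + (β : ℝ) ^ 2) ^ (σ / 2) * ‖fourierCoeffR f β‖)
    (fun β => by positivity) (fun β => by positivity)
    (by simpa only [e1] using summable_one_add_sq_rpow hτ) (by simpa only [e2] using hsum)
  simp only [e1, e2, ← e3, ← Real.sqrt_eq_rpow] at h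
  rwa [hnorm]

theorem hasSum_fourierCoeffR {f : ℝ → ℝ} (hper : Function.Periodic f 1) (hf : Continuous f)
    (hsum : Summable fun β : ℤ => ‖fourierCoeffR f β‖) (x : ℝ) :
    HasSum (fun β : ℤ => fourierCoeffR f β * fourier β (x : AddCircle (1 : ℝ))) (f x : ℂ) := by
  have hper' : Function.Periodic (fun x => (f x : ℂ)) 1 := fun x => by simp [hper x]
  let F : C(AddCircle (1 : ℝ), ℂ) :=
    ⟨hper'.lift, continuous_coinduced_dom.mpr (Complex.continuous_ofReal.comp hf)⟩
  have hF : ∀ x : ℝ, F (x : AddCircle (1 : ℝ)) = f x := fun x => rfl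
  have hcoeff : ∀ β : ℤ, fourierCoeff F β = fourierCoeffR f β := fun β => by
    rw [fourierCoeff_eq_intervalIntegral F β 0, fourierCoeffR]
    simp only [div_one, one_smul, zero_add, smul_eq_mul, hF]
    refine intervalIntegral.integral_congr fun x _ => ?_
    simp only [fourier_coe_apply]
    rw [mul_comm]
    congr 2
    push_cast
    ring
  have hs : Summable (fourierCoeff F) := by
    rw [funext hcoeff]
    exact hsum.of_norm
  have := has_pointwise_sum_fourier_series_of_summable hs (x : AddCircle (1 : ℝ))
  simpa only [hcoeff, smul_eq_mul, hF] using this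

theorem norm_fourier_coe (β : ℤ) (x : ℝ) : ‖fourier β (x : AddCircle (1 : ℝ))‖ = 1 := by
  rw [fourier_apply]
  exact Circle.norm_coe _

/-- Sobolev embedding `H^σ ⊂ C⁰` for `σ > 1/2`. -/
theorem abs_le_of_sobNormSq {σ : ℝ} (hσ : 1 / 2 < σ) {f : ℝ → ℝ}
    (hper : Function.Periodic f 1) (hf : Continuous f) (hfin : sobNormSq σ f < ⊤) (x : ℝ) :
    |f x| ≤ √(∑' β : ℤ, (1 + (β : ℝ) ^ 2) ^ (-σ)) * √((sobNormSq σ f).toReal) := by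
  obtain ⟨h1, h2⟩ := tsum_weighted_fourierCoeffR_le hσ hfin
  simp only [sub_self, zero_div, Real.rpow_zero, one_mul] at h1 h2
  have h3 := hasSum_fourierCoeffR hper hf h1 x
  have h4 := tsum_of_norm_bounded h1.hasSum
    (fun β => (by rw [norm_mul, norm_fourier_coe, mul_one] :
      ‖fourierCoeffR f β * fourier β (x : AddCircle (1 : ℝ))‖ ≤ ‖fourierCoeffR f β‖))
  rw [h3.tsum_eq, Complex.norm_real] at h4
  exact h4.trans h2

/-- Sobolev embedding `H^σ ⊂ C¹` for `σ > 3/2`. -/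
theorem continuous_deriv_and_abs_deriv_le_of_sobNormSq {σ : ℝ} (hσ : 3 / 2 < σ) {f : ℝ → ℝ}
    (hper : Function.Periodic f 1) (hf : Continuous f) (hfin : sobNormSq σ f < ⊤) :
    Continuous (deriv f) ∧ ∀ x, |deriv f x| ≤
      2 * Real.pi * (√(∑' β : ℤ, (1 + (β : ℝ) ^ 2) ^ (-(σ - 1))) *
        √((sobNormSq σ f).toReal)) := by
  obtain ⟨h1, -⟩ := tsum_weighted_fourierCoeffR_le (by linarith : 1 / 2 < σ) hfin
  simp only [sub_self, zero_div, Real.rpow_zero, one_mul] at h1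
  obtain ⟨h2, h3⟩ := tsum_weighted_fourierCoeffR_le (by linarith : 1 / 2 < σ - 1) hfin
  simp only [sub_sub_cancel, ← Real.sqrt_eq_rpow] at h2 h3
  have hsum := hasSum_fourierCoeffR hper hf h1
  let g' : ℤ → ℝ → ℂ := fun β x => fourierCoeffR f β *
    (2 * Real.pi * Complex.I * β / (1 : ℝ) * fourier β (x : AddCircle (1 : ℝ)))
  have hg' : ∀ β x, ‖g' β x‖ ≤
      2 * Real.pi * (√(1 + (β : ℝ) ^ 2) * ‖fourierCoeffR f β‖) := fun β x => by
    have hβ : |(β : ℝ)| ≤ √(1 + (β : ℝ) ^ 2) := Real.abs_le_sqrt (by linarith)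
    have : ‖g' β x‖ = 2 * Real.pi * (|(β : ℝ)| * ‖fourierCoeffR f β‖) := by
      simp only [g', norm_mul, norm_div, norm_fourier_coe, Complex.norm_I, Complex.norm_intCast,
        Complex.norm_real, Complex.norm_ofNat, Real.norm_eq_abs, abs_of_pos Real.pi_pos, abs_one]
      ring
    rw [this]
    have := Real.pi_pos
    gcongr
  have hbd := h2.mul_left (2 * Real.pi)
  have hder : ∀ x, HasDerivAt (fun y => (f y : ℂ)) (∑' β, g' β x) x := fun x => by
    have := hasDerivAt_tsum hbd
      (fun β y => (hasDerivAt_fourier 1 β y).const_mul (fourierCoeffR f β)) hg'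
      (hsum 0).summable x
    refine this.congr_of_eventuallyEq (Eventually.of_forall fun y => ?_)
    exact (hsum y).tsum_eq.symm
  have hre : ∀ x, HasDerivAt f (∑' β, g' β x).re x := fun x => by
    simpa using! Complex.reCLM.hasFDerivAt.comp_hasDerivAt x (hder x)
  have hderiv : deriv f = fun x => (∑' β, g' β x).re := funext fun x => (hre x).deriv
  refine ⟨?_, fun x => ?_⟩
  · rw [hderiv]
    refine Complex.continuous_re.comp (continuous_tsum (fun β => ?_) hbd hg')
    simp only [g', fourier_coe_apply]
    fun_prop
  · rw [hderiv]
    have h4 := tsum_of_norm_bounded hbd.hasSum fun β => hg' β x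
    rw [tsum_mul_left] at h4
    refine ((Complex.abs_re_le_norm _).trans h4).trans ?_
    have := Real.pi_pos
    gcongr

/-- A family of continuous functions depending continuously on `t` in the uniform norm is jointly
continuous. -/
theorem continuousOn_uncurry_of_abs_sub_le {I : Set ℝ} {G : ℝ → ℝ → ℝ} {N : ℝ → ℝ → ℝ≥0∞} {C : ℝ}
    (hG : ∀ t ∈ I, Continuous (G t))
    (hN : ∀ t₀ ∈ I, Tendsto (N t₀) (nhdsWithin t₀ I) (nhds 0))
    (hb : ∀ t₀ ∈ I, ∀ t ∈ I, N t₀ t < ⊤ → ∀ x, |G t x - G t₀ x| ≤ C * √((N t₀ t).toReal)) :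
    ContinuousOn (Function.uncurry G) (I ×ˢ univ) := by
  rintro ⟨t₀, x₀⟩ ⟨ht₀, -⟩
  have hfst : Tendsto Prod.fst (nhdsWithin (t₀, x₀) (I ×ˢ univ)) (nhdsWithin t₀ I) := by
    rw [nhdsWithin_prod_eq]
    exact tendsto_fst
  have hsnd : Tendsto Prod.snd (nhdsWithin (t₀, x₀) (I ×ˢ univ)) (nhds x₀) :=
    (continuous_snd.tendsto (t₀, x₀)).mono_left nhdsWithin_le_nhds
  have hN' := (hN t₀ ht₀).comp hfst
  have hsq : Tendsto (fun p : ℝ × ℝ => C * √((N t₀ p.1).toReal))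
      (nhdsWithin (t₀, x₀) (I ×ˢ univ)) (nhds 0) := by
    simpa using (((ENNReal.tendsto_toReal ENNReal.zero_ne_top).comp hN').sqrt).const_mul C
  have h1 : Tendsto (fun p : ℝ × ℝ => G p.1 p.2 - G t₀ p.2)
      (nhdsWithin (t₀, x₀) (I ×ˢ univ)) (nhds 0) := by
    refine squeeze_zero_norm' ?_ hsq
    filter_upwards [self_mem_nhdsWithin, hN'.eventually (gt_mem_nhds ENNReal.zero_lt_top)]
      with p hp hlt
    exact hb t₀ ht₀ p.1 hp.1 hlt p.2
  have h2 : Tendsto (fun p : ℝ × ℝ => G t₀ p.2)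
      (nhdsWithin (t₀, x₀) (I ×ˢ univ)) (nhds (G t₀ x₀)) :=
    ((hG t₀ ht₀).tendsto x₀).comp hsnd
  simpa [ContinuousWithinAt, Function.uncurry] using! h1.add h2

theorem ContIntoHs.continuousOn_uncurry {T σ : ℝ} (hσ : 1 / 2 < σ) {f : ℝ → ℝ → ℝ}
    (hf : ContIntoHs T σ f) (hc : ∀ t ∈ Ico 0 T, Continuous (f t)) :
    ContinuousOn (Function.uncurry f) (Ico 0 T ×ˢ univ) := by
  obtain ⟨hper, -, hlim⟩ := hf
  exact continuousOn_uncurry_of_abs_sub_le hc hlim fun t₀ ht₀ t ht hlt x =>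
    abs_le_of_sobNormSq hσ ((hper t ht).sub (hper t₀ ht₀)) ((hc t ht).sub (hc t₀ ht₀)) hlt x

theorem ContIntoHs.continuousOn_uncurry_deriv {T σ : ℝ} (hσ : 3 / 2 < σ) {f : ℝ → ℝ → ℝ}
    (hf : ContIntoHs T σ f) (hd : ∀ t ∈ Ico 0 T, Differentiable ℝ (f t)) :
    ContinuousOn (Function.uncurry fun t => deriv (f t)) (Ico 0 T ×ˢ univ) := by
  obtain ⟨hper, hfin, hlim⟩ := hf
  refine continuousOn_uncurry_of_abs_sub_le
    (C := 2 * Real.pi * √(∑' β : ℤ, (1 + (β : ℝ) ^ 2) ^ (-(σ - 1))))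
    (fun t ht => (continuous_deriv_and_abs_deriv_le_of_sobNormSq hσ (hper t ht)
      (hd t ht).continuous (hfin t ht)).1) hlim fun t₀ ht₀ t ht hlt x => ?_
  have h := (continuous_deriv_and_abs_deriv_le_of_sobNormSq hσ
    ((hper t ht).sub (hper t₀ ht₀)) ((hd t ht).continuous.sub (hd t₀ ht₀).continuous) hlt).2 x
  rw [deriv_sub (hd t ht x) (hd t₀ ht₀ x)] at h
  rwa [mul_assoc]

theorem nonneg_deriv_of_left_max {g : ℝ → ℝ} {g' t : ℝ} (hg : HasDerivAt g g' t)
    (h : ∀ᶠ τ in nhdsWithin t (Iio t), g τ ≤ g t) : 0 ≤ g' := by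
  have h1 := (hasDerivAt_iff_tendsto_slope.1 hg).mono_left
    (nhdsWithin_mono t (fun z (hz : z ∈ Iio t) => ne_of_lt hz) :
      nhdsWithin t (Iio t) ≤ nhdsWithin t {t}ᶜ)
  have : (nhdsWithin t (Iio t)).NeBot := inferInstance
  refine ge_of_tendsto h1 ?_
  filter_upwards [h, self_mem_nhdsWithin] with τ hτ hlt
  rw [slope_def_field]
  exact div_nonneg_of_nonpos (by linarith) (by linarith [show τ < t from hlt])

/-- A pointwise solution of `ρ_t = w ρ_x + w_x ρ` is bounded above along the characteristic
`y' = -w(t, y)` by the solution of the corresponding linear ODE with the same initial value. -/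
theorem transport_le_along_characteristic {t₁ : ℝ} (ht₁ : 0 < t₁) (ρ r w b : ℝ → ℝ → ℝ)
    (y P : ℝ → ℝ)
    (hρc : ContinuousOn (Function.uncurry ρ) (Icc 0 t₁ ×ˢ univ))
    (hbc : ContinuousOn (Function.uncurry b) (Icc 0 t₁ ×ˢ univ))
    (hρx : ∀ t ∈ Icc 0 t₁, ∀ x, HasDerivAt (ρ t) (r t x) x)
    (hwx : ∀ t ∈ Icc 0 t₁, ∀ x, HasDerivAt (w t) (b t x) x)
    (hρt : ∀ t ∈ Ioc 0 t₁, ∀ x,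
      HasDerivAt (fun τ => ρ τ x) (w t x * r t x + b t x * ρ t x) t)
    (hy : ContinuousOn y (Icc 0 t₁)) (hP : ContinuousOn P (Icc 0 t₁))
    (hyt : ∀ t ∈ Ioc 0 t₁, HasDerivAt y (-(w t (y t))) t)
    (hPt : ∀ t ∈ Ioc 0 t₁, HasDerivAt P (b t (y t) * P t) t)
    (hP0 : ρ 0 (y 0) = P 0) : ρ t₁ (y t₁) ≤ P t₁ := by
  by_contra! hcon
  have hS : IsCompact (Icc (0 : ℝ) t₁ ×ˢ Icc (-1 : ℝ) 1) := isCompact_Icc.prod isCompact_Icc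
  have hshift : ContinuousOn (fun p : ℝ × ℝ => (p.1, y p.1 + p.2)) (Icc 0 t₁ ×ˢ Icc (-1) 1) :=
    continuousOn_fst.prodMk
      ((hy.comp continuousOn_fst (fun p hp => hp.1)).add continuousOn_snd)
  have hmaps : MapsTo (fun p : ℝ × ℝ => (p.1, y p.1 + p.2)) (Icc 0 t₁ ×ˢ Icc (-1) 1)
      (Icc 0 t₁ ×ˢ univ) := fun p hp => ⟨hp.1, mem_univ _⟩
  have hρ' : ContinuousOn (fun p : ℝ × ℝ => ρ p.1 (y p.1 + p.2)) (Icc 0 t₁ ×ˢ Icc (-1) 1) :=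
    hρc.comp hshift hmaps
  have hb' : ContinuousOn (fun p : ℝ × ℝ => b p.1 (y p.1 + p.2)) (Icc 0 t₁ ×ˢ Icc (-1) 1) :=
    hbc.comp hshift hmaps
  have hP' : ContinuousOn (fun p : ℝ × ℝ => P p.1) (Icc 0 t₁ ×ˢ Icc (-1 : ℝ) 1) :=
    hP.comp continuousOn_fst (fun p hp => hp.1)
  obtain ⟨L, hL⟩ := hS.exists_bound_of_continuousOn hb'
  obtain ⟨R, hR⟩ := isCompact_Icc.exists_bound_of_continuousOn hP
  obtain ⟨C, hC⟩ := hS.exists_bound_of_continuousOn (hρ'.sub hP')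
  have m0 : (0 : ℝ) ∈ Icc 0 t₁ := ⟨le_rfl, ht₁.le⟩
  have m1 : t₁ ∈ Icc 0 t₁ := ⟨ht₁.le, le_rfl⟩
  have mz : (0 : ℝ) ∈ Icc (-1 : ℝ) 1 := by constructor <;> norm_num
  have hL0 : 0 ≤ L := (norm_nonneg _).trans (hL (0, 0) ⟨m0, mz⟩)
  have hR0 : 0 ≤ R := (norm_nonneg _).trans (hR 0 m0)
  have hC0 : 0 ≤ C := (norm_nonneg _).trans (hC (0, 0) ⟨m0, mz⟩)
  set K := 3 * L + 1 with hK
  set η := Real.exp (-K * t₁) * (ρ t₁ (y t₁) - P t₁) with hη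
  have hη0 : 0 < η := mul_pos (Real.exp_pos _) (by linarith)
  obtain ⟨δ₁, hδ₁, hb1⟩ := Metric.uniformContinuousOn_iff.1
    (hS.uniformContinuousOn_of_continuous hb') (η / (R + 1)) (by positivity)
  obtain ⟨δ₂, hδ₂, hρ1⟩ := Metric.uniformContinuousOn_iff.1
    (hS.uniformContinuousOn_of_continuous hρ') η hη0
  obtain ⟨a, ha0, ha1, haδ₁, haδ₂⟩ : ∃ a : ℝ, 0 < a ∧ a ≤ 1 ∧ a < δ₁ ∧ a < δ₂ := by
    refine ⟨min 1 (min (δ₁ / 2) (δ₂ / 2)), by positivity, min_le_left _ _, ?_, ?_⟩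
    · exact (((min_le_right _ _).trans (min_le_left _ _)).trans_lt (half_lt_self hδ₁))
    · exact (((min_le_right _ _).trans (min_le_right _ _)).trans_lt (half_lt_self hδ₂))
  set A := (C + 1) / a ^ 2 with hA
  have hA0 : 0 < A := by positivity
  have hAa : A * a ^ 2 = C + 1 := by rw [hA]; field_simp
  have hsub : Icc (0 : ℝ) t₁ ×ˢ Icc (-a) a ⊆ Icc 0 t₁ ×ˢ Icc (-1) 1 :=
    prod_mono le_rfl (Icc_subset_Icc (by linarith) ha1)
  have hFc : ContinuousOn (fun p : ℝ × ℝ =>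
      Real.exp (-K * p.1) * (ρ p.1 (y p.1 + p.2) - P p.1) - A * p.2 ^ 2)
      (Icc 0 t₁ ×ˢ Icc (-a) a) := by
    refine ContinuousOn.sub (ContinuousOn.mul (by fun_prop) ((hρ'.sub hP').mono hsub))
      (by fun_prop)
  obtain ⟨⟨t, d⟩, ⟨ht, hd⟩, hmax⟩ := (isCompact_Icc.prod isCompact_Icc).exists_isMaxOn
    ⟨(t₁, 0), m1, by simpa using ha0.le⟩ hFc
  simp only at ht hd
  have hmax' : ∀ τ ∈ Icc 0 t₁, ∀ e ∈ Icc (-a) a,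
      Real.exp (-K * τ) * (ρ τ (y τ + e) - P τ) - A * e ^ 2 ≤
      Real.exp (-K * t) * (ρ t (y t + d) - P t) - A * d ^ 2 :=
    fun τ hτ e he => hmax (show (τ, e) ∈ _ from ⟨hτ, he⟩)
  have hval : η ≤ Real.exp (-K * t) * (ρ t (y t + d) - P t) - A * d ^ 2 := by
    have := hmax' t₁ m1 0 (by simpa using ha0.le)
    simpa [hη] using this
  have hd1 : d ∈ Icc (-1 : ℝ) 1 := ⟨by linarith [hd.1], by linarith [hd.2]⟩
  have hE1 : Real.exp (-K * t) ≤ 1 := Real.exp_le_one_iff.2 (by nlinarith [ht.1])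
  have hE0 := Real.exp_pos (-K * t)
  have hAd : 0 ≤ A * d ^ 2 := by positivity
  have hdlt : |d| < a := by
    refine lt_of_le_of_ne (abs_le.2 hd) fun h => ?_
    have h2 : A * d ^ 2 = C + 1 := by rw [← sq_abs, h, hAa]
    have h3 := (abs_le.1 (hC (t, d) ⟨ht, hd1⟩)).2
    simp only [Pi.sub_apply] at h3
    have : Real.exp (-K * t) * (ρ t (y t + d) - P t) ≤ C :=
      (mul_le_mul_of_nonneg_left h3 hE0.le).trans (mul_le_of_le_one_left hC0 hE1)
    linarith
  have ht0 : 0 < t := by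
    refine lt_of_le_of_ne ht.1 fun h => ?_
    subst h
    have h1 := hρ1 (0, d) ⟨m0, hd1⟩ (0, 0) ⟨m0, mz⟩ (by
      rw [Prod.dist_eq]; simpa using hdlt.trans haδ₂)
    simp only [add_zero, Real.dist_eq] at h1
    have h2 := (abs_lt.1 h1).2
    simp only [mul_zero, Real.exp_zero, one_mul] at hval
    linarith
  have htI : t ∈ Ioc 0 t₁ := ⟨ht0, ht.2⟩
  have hx0 : Real.exp (-K * t) * r t (y t + d) = 2 * A * d := by
    have hder : HasDerivAt (fun e => Real.exp (-K * t) * (ρ t (y t + e) - P t) - A * e ^ 2)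
        (Real.exp (-K * t) * r t (y t + d) - A * (2 * d)) d := by
      have h1 := ((hρx t ht (y t + d)).comp_const_add (y t) d).sub_const (P t)
      have h2 : HasDerivAt (fun e => A * e ^ 2) (A * (2 * d)) d := by
        simpa using (hasDerivAt_pow 2 d).const_mul A
      exact (h1.const_mul (Real.exp (-K * t))).fun_sub h2
    have hloc : IsLocalMax
        (fun e => Real.exp (-K * t) * (ρ t (y t + e) - P t) - A * e ^ 2) d := by
      filter_upwards [Ioo_mem_nhds (abs_lt.1 hdlt).1 (abs_lt.1 hdlt).2] with e he
      exact hmax' t ht e ⟨he.1.le, he.2.le⟩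
    have := hloc.hasDerivAt_eq_zero hder
    linarith
  have htd := nonneg_deriv_of_left_max (t := t)
    (g := fun τ => Real.exp (-K * τ) * (ρ τ (y t + d) - P τ) - A * (y t + d - y τ) ^ 2)
    ((((hasDerivAt_id t).const_mul (-K)).exp.mul ((hρt t htI (y t + d)).sub (hPt t htI))).sub
      ((((hyt t htI).const_sub (y t + d)).pow 2).const_mul A)) (by
    have hc : ContinuousAt (fun τ => y t + d - y τ) t :=
      continuousAt_const.sub (hyt t htI).continuousAt
    have hmem : ∀ᶠ τ in nhds t, y t + d - y τ ∈ Ioo (-a) a :=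
      hc.eventually_mem (by
        rw [add_sub_cancel_left]
        exact Ioo_mem_nhds (abs_lt.1 hdlt).1 (abs_lt.1 hdlt).2)
    filter_upwards [self_mem_nhdsWithin, nhdsWithin_le_nhds hmem,
      nhdsWithin_le_nhds (Ioi_mem_nhds ht0)] with τ h1 h2 h3
    have := hmax' τ ⟨le_of_lt h3, (le_of_lt h1).trans ht.2⟩ (y t + d - y τ) ⟨h2.1.le, h2.2.le⟩
    simpa using this)
  simp only [id, mul_one, add_sub_cancel_left, Nat.cast_ofNat, pow_one, Nat.add_one_sub_one,
    neg_neg, Pi.sub_apply] at htd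
  have hbx : |b t (y t + d)| ≤ L := hL (t, d) ⟨ht, hd1⟩
  have hw : |w t (y t + d) - w t (y t)| ≤ L * |d| := by
    have := (convex_Icc (y t - 1) (y t + 1)).norm_image_sub_le_of_norm_hasDerivWithin_le
      (f := w t) (f' := b t) (C := L) (x := y t) (y := y t + d)
      (fun z _ => (hwx t ht z).hasDerivWithinAt)
      (fun z hz => by
        have := hL (t, z - y t) ⟨ht, by constructor <;> linarith [hz.1, hz.2]⟩
        simpa using this)
      (by constructor <;> linarith) (by constructor <;> linarith [hd1.1, hd1.2])
    simpa using this
  have hbb : |b t (y t + d) - b t (y t)| < η / (R + 1) := by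
    have := hb1 (t, d) ⟨ht, hd1⟩ (t, 0) ⟨ht, mz⟩ (by
      rw [Prod.dist_eq]; simpa using hdlt.trans haδ₁)
    simpa [Real.dist_eq] using this
  have hPR : |P t| ≤ R := hR t ht
  set E := Real.exp (-K * t)
  set D := E * (ρ t (y t + d) - P t) with hD
  have hDη : η + A * d ^ 2 ≤ D := by linarith
  have e1 : E * ((b t (y t + d) - b t (y t)) * P t) < η := by
    have h1 : |(b t (y t + d) - b t (y t)) * P t| < η := by
      rw [abs_mul]
      calc _ ≤ η / (R + 1) * R := by gcongr
        _ < η := by rw [div_mul_eq_mul_div, div_lt_iff₀ (by linarith)]; nlinarith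
    calc _ ≤ E * |(b t (y t + d) - b t (y t)) * P t| := by gcongr; exact le_abs_self _
      _ ≤ |(b t (y t + d) - b t (y t)) * P t| := mul_le_of_le_one_left (abs_nonneg _) hE1
      _ < η := h1
  have e2 : d * (w t (y t + d) - w t (y t)) ≤ L * d ^ 2 := by
    calc _ ≤ |d * (w t (y t + d) - w t (y t))| := le_abs_self _
      _ = |d| * |w t (y t + d) - w t (y t)| := abs_mul _ _
      _ ≤ |d| * (L * |d|) := by gcongr
      _ = L * d ^ 2 := by rw [← sq_abs d]; ring
  have e3 : b t (y t + d) * D ≤ L * D := by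
    have : 0 ≤ D := by linarith
    gcongr
    exact (abs_le.1 hbx).2
  have e4 : 2 * A * (d * (w t (y t + d) - w t (y t))) ≤ 2 * A * (L * d ^ 2) := by gcongr
  have e5 : L * (A * d ^ 2) ≤ L * D := by gcongr; linarith
  have key : 0 ≤ -K * D + 2 * A * (d * (w t (y t + d) - w t (y t))) + b t (y t + d) * D
      + E * ((b t (y t + d) - b t (y t)) * P t) := by
    have : -K * D + 2 * A * (d * (w t (y t + d) - w t (y t))) + b t (y t + d) * D
      + E * ((b t (y t + d) - b t (y t)) * P t) = -K * D
      + (w t (y t + d) * (2 * A * d)) + E * (b t (y t + d) * ρ t (y t + d) - b t (y t) * P t)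
      - A * (2 * d * w t (y t)) := by rw [hD]; ring
    rw [this, ← hx0, hD]
    linarith
  nlinarith

/-- (Lemma 4.3, first part) Let `u ∈ C([0,T); H^s) ∩ C¹([0,T); H^{s-1})`,
`ρ ∈ C([0,T); H^{s-1}) ∩ C¹([0,T); H^{s-2})`, `s > 3/2`, solve
`ρ_t - (u + 2γ₂)ρ_x = u_x ρ`, and let `q` be the flow of `u(t,-·) + 2γ₂` with
`q(0,x) = x` and `q_x(t,x) = exp(-∫₀ᵗ u_x(τ,-q(τ,x)) dτ)`. Then
`ρ(t,-q(t,x)) q_x(t,x) = ρ₀(-x)` for all `(t,x) ∈ [0,T) × S`. -/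
theorem flow_conjugation_identity (T s γ₂ : ℝ) (hT : 0 < T) (hs : 3/2 < s)
    (u ρ q : ℝ → ℝ → ℝ)
    (hu : ContIntoHs T s u) (hu1 : C1IntoHs T (s - 1) u)
    (hρ : ContIntoHs T (s - 1) ρ) (hρ1 : C1IntoHs T (s - 2) ρ)
    (hρdiff : ∀ t ∈ Ico 0 T, Differentiable ℝ (ρ t))
    (hudiff : ∀ t ∈ Ico 0 T, Differentiable ℝ (u t))
    (heq : ∀ x : ℝ, ∀ t ∈ Ico 0 T,
      HasDerivAt (fun τ => ρ τ x)
        ((u t x + 2 * γ₂) * deriv (ρ t) x + deriv (u t) x * ρ t x) t)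
    (hq0 : ∀ x : ℝ, q 0 x = x)
    (hqt : ∀ x : ℝ, ∀ t ∈ Ico 0 T,
      HasDerivAt (fun τ => q τ x) (u t (-(q t x)) + 2 * γ₂) t)
    (hqx : ∀ t ∈ Ico 0 T, ∀ x : ℝ,
      HasDerivAt (q t) (Real.exp (-∫ τ in (0:ℝ)..t, deriv (u τ) (-(q τ x)))) x) :
    ∀ t ∈ Ico 0 T, ∀ x : ℝ, ρ t (-(q t x)) * deriv (q t) x = ρ 0 (-x) := by
  intro t₁ ht₁ x
  rw [(hqx t₁ ht₁ x).deriv]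
  rcases ht₁.1.eq_or_lt with h0 | hpos
  · subst h0
    simp [hq0]
  have hsub : Icc 0 t₁ ⊆ Ico 0 T := fun t ht => ⟨ht.1, ht.2.trans_lt ht₁.2⟩
  have hsub' : Ioc 0 t₁ ⊆ Ioo 0 T := fun t ht => ⟨ht.1, ht.2.trans_lt ht₁.2⟩
  have hρc := hρ.continuousOn_uncurry (by linarith) fun t ht => (hρdiff t ht).continuous
  have hbc := hu.continuousOn_uncurry_deriv hs hudiff
  have hyt : ∀ t ∈ Ico 0 T, HasDerivAt (fun τ => -(q τ x)) (-(u t (-(q t x)) + 2 * γ₂)) t :=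
    fun t ht => (hqt x t ht).fun_neg
  have hyc : ContinuousOn (fun τ => -(q τ x)) (Ico 0 T) := fun t ht =>
    (hyt t ht).continuousAt.continuousWithinAt
  have hβc : ContinuousOn (fun τ => deriv (u τ) (-(q τ x))) (Ico 0 T) :=
    hbc.comp (continuousOn_id.prodMk hyc) fun t ht => ⟨ht, mem_univ _⟩
  have hint : ∀ t ∈ Ico 0 T,
      IntervalIntegrable (fun τ => deriv (u τ) (-(q τ x))) volume 0 t := fun t ht =>
    (hβc.mono (by
      rw [uIcc_of_le ht.1]
      exact fun τ hτ => ⟨hτ.1, hτ.2.trans_lt ht.2⟩)).intervalIntegrable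
  let J : ℝ → ℝ := fun t => ∫ τ in (0:ℝ)..t, deriv (u τ) (-(q τ x))
  have hJd : ∀ t ∈ Ioo 0 T, HasDerivAt J (deriv (u t) (-(q t x))) t := fun t ht =>
    intervalIntegral.integral_hasDerivAt_right (hint t ⟨ht.1.le, ht.2⟩)
      ((hβc.mono Ioo_subset_Ico_self).stronglyMeasurableAtFilter isOpen_Ioo t ht)
      ((hβc.mono Ioo_subset_Ico_self).continuousAt (isOpen_Ioo.mem_nhds ht))
  have hJc : ContinuousOn J (Icc 0 t₁) := by
    have := intervalIntegral.continuousOn_primitive_interval'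
      (hint t₁ ht₁) (left_mem_uIcc (a := (0 : ℝ)) (b := t₁))
    rwa [uIcc_of_le hpos.le] at this
  let P : ℝ → ℝ := fun t => ρ 0 (-x) * Real.exp (J t)
  have hPc : ContinuousOn P (Icc 0 t₁) := continuousOn_const.mul hJc.rexp
  have hPd : ∀ t ∈ Ioc 0 t₁, HasDerivAt P (deriv (u t) (-(q t x)) * P t) t := fun t ht => by
    convert! ((hJd t (hsub' ht)).exp.const_mul (ρ 0 (-x))) using 1
    simp only [P]
    ring
  have hP0 : P 0 = ρ 0 (-x) := by simp [P, J]
  have hwx : ∀ t ∈ Icc 0 t₁, ∀ z,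
      HasDerivAt (fun z => u t z + 2 * γ₂) (deriv (u t) z) z := fun t ht z =>
    ((hudiff t (hsub ht) z).hasDerivAt).add_const _
  have hprod : Icc 0 t₁ ×ˢ (univ : Set ℝ) ⊆ Ico 0 T ×ˢ univ := prod_mono hsub le_rfl
  have hupper : ρ t₁ (-(q t₁ x)) ≤ P t₁ :=
    transport_le_along_characteristic hpos ρ (fun t => deriv (ρ t)) (fun t z => u t z + 2 * γ₂)
      (fun t => deriv (u t)) (fun τ => -(q τ x)) P (hρc.mono hprod) (hbc.mono hprod)
      (fun t ht z => (hρdiff t (hsub ht) z).hasDerivAt) hwx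
      (fun t ht z => heq z t (hsub (Ioc_subset_Icc_self ht))) (hyc.mono hsub) hPc
      (fun t ht => hyt t (hsub (Ioc_subset_Icc_self ht))) hPd (by simp [hP0, hq0])
  have hlower : -ρ t₁ (-(q t₁ x)) ≤ -P t₁ :=
    transport_le_along_characteristic hpos (fun t z => -ρ t z) (fun t z => -deriv (ρ t) z)
      (fun t z => u t z + 2 * γ₂) (fun t => deriv (u t)) (fun τ => -(q τ x)) (fun t => -P t)
      (hρc.mono hprod).neg (hbc.mono hprod)
      (fun t ht z => (hρdiff t (hsub ht) z).hasDerivAt.fun_neg) hwx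
      (fun t ht z => by
        convert! (heq z t (hsub (Ioc_subset_Icc_self ht))).fun_neg using 1
        ring) (hyc.mono hsub) hPc.neg
      (fun t ht => hyt t (hsub (Ioc_subset_Icc_self ht)))
      (fun t ht => by
        convert! (hPd t ht).fun_neg using 1
        ring) (by simp [hP0, hq0])
  have heqP : ρ t₁ (-(q t₁ x)) = P t₁ := by linarith
  rw [heqP, mul_assoc, ← Real.exp_add, add_neg_cancel, Real.exp_zero, mul_one]

end
end
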